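/- There exist absolute constants c > 0 and C > 0 such that for all real x ≥ y ≥ 2 and all real Z with 0 ≤ Z ≤ c·ū^{1/4}, the inequality w_n ≥ Z⁴ holds for all n ∈ S(x,y) with at most C·e^{−c·√ū/(Z+1)}·Ψ(x,y) exceptions, i.e. #{n ∈ S(x,y) : w_n < Z⁴} ≤ C·e^{−c·√ū/(Z+1)}·Ψ(x,y). -/

import Mathlib

open Finset MeasureTheory
open scoped Classical

noncomputable section

/-- The set of primes `p ≤ y`. -/
def primesUpTo (y : ℝ) : Finset ℕ := (Finset.range (⌊y⌋₊ + 1)).filter Nat.Prime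

/-- `S(x,y)`: the set of `y`-friable integers in `[1,x]`. -/
def Sf (x y : ℝ) : Finset ℕ :=
  (Finset.Icc 1 ⌊x⌋₊).filter fun n => ∀ p : ℕ, p.Prime → p ∣ n → (p : ℝ) ≤ y

/-- `Ψ(x,y)`. -/
def Psi (x y : ℝ) : ℝ := (Sf x y).card

/-- `u = log x / log y`. -/
def uQ (x y : ℝ) : ℝ := Real.log x / Real.log y

/-- `ū = min(u, π(y))`. -/
def ubar (x y : ℝ) : ℝ := min (uQ x y) ((primesUpTo y).card)

/-- `ν_{x,y}(A) = |A ∩ S(x,y)| / Ψ(x,y)`. -/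
def nuMeas (x y : ℝ) (A : Set ℕ) : ℝ :=
  (((Sf x y).filter fun n => n ∈ A).card : ℝ) / Psi x y

/-- `P(D_n ≥ t) = #{d ∣ n : log d ≥ t} / τ(n)`. -/
def DnProb (n : ℕ) (t : ℝ) : ℝ :=
  ((n.divisors.filter fun d => t ≤ Real.log d).card : ℝ) / (n.divisors.card : ℝ)

/-- `m_{2,n}`. -/
def m2 (n : ℕ) : ℝ :=
  (1 / 12) * ∑ p ∈ n.primeFactors,
    (n.factorization p : ℝ) * ((n.factorization p : ℝ) + 2) * Real.log p ^ 2

/-- `m_{4,n}`. -/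
def m4 (n : ℕ) : ℝ :=
  (1 / 240) * ∑ p ∈ n.primeFactors,
    (n.factorization p : ℝ) * ((n.factorization p : ℝ) + 2) *
      (3 * (n.factorization p : ℝ) ^ 2 + 6 * (n.factorization p : ℝ) - 4) * Real.log p ^ 4

/-- `σ_n = √(m_{2,n})`. -/
def sigman (n : ℕ) : ℝ := Real.sqrt (m2 n)

/-- `w_n = m_{2,n}² / m_{4,n}`, with `w_1 = 1`. -/
def wn (n : ℕ) : ℝ := if n = 1 then 1 else m2 n ^ 2 / m4 n

/-- `Φ(z) = (1/√(2π)) ∫_z^∞ e^{-t²/2} dt`. -/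
def GaussPhi (z : ℝ) : ℝ :=
  (1 / Real.sqrt (2 * Real.pi)) * ∫ t in Set.Ioi z, Real.exp (-t ^ 2 / 2)

/-- `ω̃_{x,y}(n)`. -/
def omegaTilde (x y : ℝ) (n : ℕ) : ℕ :=
  ((n.primeFactors).filter fun p : ℕ =>
    Real.sqrt y < (p : ℝ) ∧ (p : ℝ) ≤ y ∧
      uQ x y / (2 * ubar x y) ≤ (n.factorization p : ℝ) ∧
      (n.factorization p : ℝ) ≤ 2 * uQ x y / ubar x y).card

/-- The saddle-point equation defining `α(x,y)`. -/
def saddleEq (x y α : ℝ) : Prop :=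
  ∑ p ∈ primesUpTo y, Real.log p / ((p : ℝ) ^ α - 1) = Real.log x

/-- `σ̄(x,y)` (in terms of `y` and `α`). -/
def sigmaBar (y α : ℝ) : ℝ :=
  Real.sqrt ((1 / 2) * ∑ p ∈ primesUpTo y,
    ((p : ℝ) ^ α - 1 / 3) * Real.log p ^ 2 / ((p : ℝ) ^ α - 1) ^ 2)

/-- `ζ(α,y)`. -/
def zetaY (y α : ℝ) : ℝ := ∏ p ∈ primesUpTo y, (1 - (p : ℝ) ^ (-α))⁻¹

/-- `f_k(n) = ∑_{p^ν ‖ n} (ν log p)^k`. -/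
def fk (k : ℕ) (n : ℕ) : ℝ :=
  ∑ p ∈ n.primeFactors, ((n.factorization p : ℝ) * Real.log p) ^ k

/-- `A_f(x,y) = ∑_{p ≤ y} ∑_{ν ≥ 1} f(p^ν) p^{-να} (1 - p^{-α})`. -/
def Af (y α : ℝ) (f : ℕ → ℝ) : ℝ :=
  ∑ p ∈ primesUpTo y, ∑' ν : ℕ,
    f (p ^ (ν + 1)) * (p : ℝ) ^ (-(((ν : ℝ) + 1) * α)) * (1 - (p : ℝ) ^ (-α))

/-- `Z_n(β)` for real `β` (each Euler factor written as the everywhere-defined mean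
`(1/(ν+1)) ∑_{0 ≤ j ≤ ν} p^{jβ}`, which is the continuous extension of
`(p^{(ν+1)β}-1)/((ν+1)(p^β-1))`). -/
def ZnR (n : ℕ) (β : ℝ) : ℝ :=
  ∏ p ∈ n.primeFactors,
    (∑ j ∈ Finset.range (n.factorization p + 1), (p : ℝ) ^ ((j : ℝ) * β)) /
      ((n.factorization p : ℝ) + 1)

/-- `φ_n = log Z_n` on the reals. -/
def phiN (n : ℕ) (β : ℝ) : ℝ := Real.log (ZnR n β)

/-- `Z_n(s)` for complex `s`. -/
def ZnC (n : ℕ) (s : ℂ) : ℂ :=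
  ∏ p ∈ n.primeFactors,
    (∑ j ∈ Finset.range (n.factorization p + 1), (p : ℂ) ^ ((j : ℂ) * s)) /
      ((n.factorization p : ℂ) + 1)

/-- Distance from `θ` to the nearest integer. -/
def nid (θ : ℝ) : ℝ := |θ - round θ|

/-- `V_y(s) = (y^{1-s} - 1)/(1 - s)`, extended by continuity at `s = 1`. -/
def Vy (y : ℝ) (s : ℂ) : ℂ :=
  if s = 1 then (Real.log y : ℂ) else (((y : ℝ) : ℂ) ^ (1 - s) - 1) / (1 - s)

theorem mem_Sf {x y : ℝ} {n : ℕ} :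
    n ∈ Sf x y ↔ n ≠ 0 ∧ (n : ℝ) ≤ x ∧ ∀ p : ℕ, p.Prime → p ∣ n → (p : ℝ) ≤ y := by
  unfold Sf
  rw [Finset.mem_filter, Finset.mem_Icc, Nat.one_le_iff_ne_zero, and_assoc]
  constructor
  · rintro ⟨h0, h1, h2⟩
    exact ⟨h0, (Nat.le_floor_iff' h0).1 h1, h2⟩
  · rintro ⟨h0, h1, h2⟩
    exact ⟨h0, (Nat.le_floor_iff' h0).2 h1, h2⟩

theorem mem_primesUpTo {y : ℝ} {p : ℕ} : p ∈ primesUpTo y ↔ p.Prime ∧ (p : ℝ) ≤ y := by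
  unfold primesUpTo
  rw [Finset.mem_filter, Finset.mem_range, Nat.lt_succ_iff, and_comm]
  exact and_congr_right fun hp => Nat.le_floor_iff' hp.ne_zero

theorem primeFactors_subset_primesUpTo {x y : ℝ} {n : ℕ} (hn : n ∈ Sf x y) :
    n.primeFactors ⊆ primesUpTo y := fun p hp => by
  have hp' := Nat.mem_primeFactors.1 hp
  exact mem_primesUpTo.2 ⟨hp'.1, (mem_Sf.1 hn).2.2 p hp'.1 hp'.2.1⟩

theorem Psi_nonneg (x y : ℝ) : 0 ≤ Psi x y := Nat.cast_nonneg _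

theorem Sf_mono {x x' y : ℝ} (h : x ≤ x') : Sf x y ⊆ Sf x' y := fun n hn => by
  rw [mem_Sf] at hn ⊢
  exact ⟨hn.1, hn.2.1.trans h, hn.2.2⟩

theorem Psi_mono {x x' y : ℝ} (h : x ≤ x') : Psi x y ≤ Psi x' y :=
  Nat.cast_le.2 (Finset.card_le_card (Sf_mono h))

/-- The logarithmic size `ν log p` of the prime power `p^ν ‖ n`. -/
def blk (n p : ℕ) : ℝ := (n.factorization p : ℝ) * Real.log p

theorem blk_nonneg (n p : ℕ) : 0 ≤ blk n p :=
  mul_nonneg (Nat.cast_nonneg _) (Real.log_natCast_nonneg p)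

theorem blk_mul {m n : ℕ} (hm : m ≠ 0) (hn : n ≠ 0) (p : ℕ) :
    blk (m * n) p = blk m p + blk n p := by
  simp only [blk, Nat.factorization_mul hm hn, Finsupp.add_apply, Nat.cast_add, add_mul]

theorem sum_blk_of_subset {n : ℕ} (hn : n ≠ 0) {s : Finset ℕ} (hs : n.primeFactors ⊆ s) :
    ∑ p ∈ s, blk n p = Real.log n := by
  rw [← Finset.sum_subset hs]
  · conv_rhs => rw [← Nat.prod_factorization_pow_eq_self hn]
    rw [Finsupp.prod, Nat.cast_prod, Real.log_prod, Nat.support_factorization]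
    · refine Finset.sum_congr rfl fun p _ => ?_
      rw [Nat.cast_pow, Real.log_pow, blk]
    · intro p hp
      have : p.Prime := Nat.prime_of_mem_primeFactors (by simpa using hp)
      exact_mod_cast pow_ne_zero _ this.ne_zero
  · intro p _ hp
    rw [blk, Finsupp.notMem_support_iff.1 (by simpa using hp)]
    simp

theorem sum_blk {n : ℕ} (hn : n ≠ 0) : ∑ p ∈ n.primeFactors, blk n p = Real.log n :=
  sum_blk_of_subset hn subset_rfl

theorem log_le_of_mem_Sf {t y : ℝ} {n : ℕ} (hn : n ∈ Sf (Real.exp t) y) : Real.log n ≤ t := by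
  rw [mem_Sf] at hn
  exact (Real.log_le_iff_le_exp (by exact_mod_cast Nat.pos_of_ne_zero hn.1)).2 hn.2.1

/-- Multiples of a `y`-friable `d` are at least as frequent as all friable integers below `x / d`. -/
theorem Psi_le_card_multiples {x y w : ℝ} {d : ℕ} (hd : d ≠ 0)
    (hdy : ∀ p : ℕ, p.Prime → p ∣ d → (p : ℝ) ≤ y) (hw : d * w ≤ x) :
    Psi w y ≤ ((Sf x y).filter fun n => d ∣ n).card := by
  refine Nat.cast_le.2 (Finset.card_le_card_of_injOn (fun m => d * m) ?_ ?_)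
  · intro m hm
    rw [Finset.mem_coe, mem_Sf] at hm
    rw [Finset.mem_coe, Finset.mem_filter, mem_Sf]
    refine ⟨⟨mul_ne_zero hd hm.1, ?_, ?_⟩, dvd_mul_right _ _⟩
    · push_cast
      exact (mul_le_mul_of_nonneg_left hm.2.1 (Nat.cast_nonneg _)).trans hw
    · intro p hp hpd
      exact ((Nat.Prime.dvd_mul hp).1 hpd).elim (hdy p hp) (hm.2.2 p hp)
  · intro a _ b _ hab
    exact Nat.eq_of_mul_eq_mul_left (Nat.pos_of_ne_zero hd) hab

theorem mul_Psi_le_sum_factorization {t s y : ℝ} {p : ℕ} (hp : p.Prime) (hpy : (p : ℝ) ≤ y)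
    (J : ℕ) (hJ : J * Real.log p ≤ s) :
    J * Psi (Real.exp (t - s)) y ≤ ∑ n ∈ Sf (Real.exp t) y, (n.factorization p : ℝ) := by
  have hpos : (0:ℝ) < p := by exact_mod_cast hp.pos
  have h1 : ∀ n ∈ Sf (Real.exp t) y,
      (∑ j ∈ Finset.Icc 1 J, if p ^ j ∣ n then (1:ℝ) else 0) ≤ (n.factorization p : ℝ) := by
    intro n hn
    rw [← Finset.sum_filter, Finset.sum_const, nsmul_eq_mul, mul_one]
    refine Nat.cast_le.2 ?_
    calc _ ≤ (Finset.Icc 1 (n.factorization p)).card := by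
            refine Finset.card_le_card fun j hj => ?_
            rw [Finset.mem_filter, Finset.mem_Icc] at hj
            exact Finset.mem_Icc.2 ⟨hj.1.1,
              (hp.pow_dvd_iff_le_factorization (mem_Sf.1 hn).1).1 hj.2⟩
      _ = _ := by simp
  refine le_trans ?_ (Finset.sum_le_sum h1)
  rw [Finset.sum_comm]
  calc (J:ℝ) * Psi (Real.exp (t - s)) y
      = ∑ j ∈ Finset.Icc 1 J, Psi (Real.exp (t - s)) y := by simp
    _ ≤ _ := by
        refine Finset.sum_le_sum fun j hj => ?_
        rw [← Finset.sum_filter, Finset.sum_const, nsmul_eq_mul, mul_one]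
        refine Psi_le_card_multiples (pow_ne_zero _ hp.ne_zero) ?_ ?_
        · intro q hq hqd
          rwa [(Nat.prime_dvd_prime_iff_eq hq hp).1 (hq.dvd_of_dvd_pow hqd)]
        · push_cast
          rw [← Real.exp_log hpos, ← Real.exp_nat_mul, ← Real.exp_add]
          refine Real.exp_le_exp.2 ?_
          have : (j:ℝ) * Real.log p ≤ J * Real.log p :=
            mul_le_mul_of_nonneg_right (Nat.cast_le.2 (Finset.mem_Icc.1 hj).2)
              (Real.log_natCast_nonneg p)
          linarith

theorem sum_primes_le {t y : ℝ} :
    ∑ p ∈ primesUpTo y, Real.log p * ∑ n ∈ Sf (Real.exp t) y, (n.factorization p : ℝ) ≤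
      t * Psi (Real.exp t) y := by
  calc _ = ∑ n ∈ Sf (Real.exp t) y, ∑ p ∈ primesUpTo y, blk n p := by
        rw [Finset.sum_comm]
        refine Finset.sum_congr rfl fun p _ => ?_
        rw [Finset.mul_sum]
        exact Finset.sum_congr rfl fun n _ => mul_comm _ _
    _ ≤ ∑ n ∈ Sf (Real.exp t) y, t := by
        refine Finset.sum_le_sum fun n hn => ?_
        rw [sum_blk_of_subset (mem_Sf.1 hn).1 (primeFactors_subset_primesUpTo hn)]
        exact log_le_of_mem_Sf hn
    _ = _ := by rw [Finset.sum_const, nsmul_eq_mul, mul_comm, Psi]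

theorem three_mul_Psi_le {t h y : ℝ} (hy : 2 ≤ y) (hL : Real.log y ≤ h)
    (ht : t ≤ (primesUpTo y).card * h) :
    3 * Psi (Real.exp (t - 4 * h)) y ≤ Psi (Real.exp t) y := by
  have hLpos : 0 < Real.log y := Real.log_pos (by linarith)
  have hk : 0 < ((primesUpTo y).card : ℝ) := by
    exact_mod_cast Finset.card_pos.2 ⟨2, mem_primesUpTo.2 ⟨Nat.prime_two, by exact_mod_cast hy⟩⟩
  have hN := Psi_nonneg (Real.exp t) y
  have hh : 0 < h := hLpos.trans_le hL
  have key : ∑ p ∈ primesUpTo y, 3 * h * Psi (Real.exp (t - 4 * h)) y ≤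
      t * Psi (Real.exp t) y := by
    refine le_trans (Finset.sum_le_sum fun p hp => ?_) sum_primes_le
    obtain ⟨hp, hpy⟩ := mem_primesUpTo.1 hp
    have hl : 0 < Real.log p := Real.log_pos (by exact_mod_cast hp.one_lt)
    have hlL : Real.log p ≤ Real.log y := Real.log_le_log (by exact_mod_cast hp.pos) hpy
    have h1 := mul_Psi_le_sum_factorization (t := t) (s := 4 * h) hp hpy ⌊4 * h / Real.log p⌋₊
      ((le_div_iff₀ hl).1 (Nat.floor_le (by positivity)))
    have h2 : 3 * h ≤ Real.log p * (⌊4 * h / Real.log p⌋₊ : ℝ) := by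
      have h3 : 4 * h / Real.log p < ⌊4 * h / Real.log p⌋₊ + 1 := Nat.lt_floor_add_one _
      rw [div_lt_iff₀ hl] at h3
      linarith
    calc 3 * h * Psi (Real.exp (t - 4 * h)) y
        ≤ Real.log p * (⌊4 * h / Real.log p⌋₊ : ℝ) * Psi (Real.exp (t - 4 * h)) y :=
          mul_le_mul_of_nonneg_right h2 (Psi_nonneg _ _)
      _ ≤ _ := by
          rw [mul_assoc]
          exact mul_le_mul_of_nonneg_left h1 hl.le
  rw [Finset.sum_const, nsmul_eq_mul] at key
  have hkh : 0 < ((primesUpTo y).card : ℝ) * h := mul_pos hk hh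
  have h4 := mul_le_mul_of_nonneg_right ht hN
  refine le_of_mul_le_mul_left ?_ hkh
  linarith

/-- Exponential decay of `Ψ(x / e^s, y)` in `s`, at the natural scale `h`. -/
theorem Psi_decay {t h y : ℝ} (hy : 2 ≤ y) (hL : Real.log y ≤ h)
    (ht : t ≤ (primesUpTo y).card * h) {s : ℝ} (hs : 0 ≤ s) :
    Psi (Real.exp (t - s)) y ≤ Real.exp (1 - s / (4 * h)) * Psi (Real.exp t) y := by
  have hLpos : 0 < Real.log y := Real.log_pos (by linarith)
  have hh : 0 < h := hLpos.trans_le hL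
  have key : ∀ j : ℕ, Real.exp j * Psi (Real.exp (t - 4 * h * j)) y ≤ Psi (Real.exp t) y := by
    intro j
    induction j with
    | zero => simp
    | succ j ih =>
      refine le_trans ?_ ih
      have h1 := three_mul_Psi_le (t := t - 4 * h * j) hy hL (by
        have : 0 ≤ 4 * h * j := by positivity
        linarith)
      have h2 : Real.exp 1 ≤ 3 := Real.exp_one_lt_three.le
      push_cast
      rw [Real.exp_add, mul_assoc]
      refine mul_le_mul_of_nonneg_left ?_ (Real.exp_pos _).le
      rw [show t - 4 * h * (j + 1) = t - 4 * h * j - 4 * h by ring]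
      exact (mul_le_mul_of_nonneg_right h2 (Psi_nonneg _ _)).trans h1
  have h3 := key ⌊s / (4 * h)⌋₊
  have h4 : (⌊s / (4 * h)⌋₊ : ℝ) ≤ s / (4 * h) := Nat.floor_le (by positivity)
  have h5 : s / (4 * h) < ⌊s / (4 * h)⌋₊ + 1 := Nat.lt_floor_add_one _
  rw [le_div_iff₀ (by positivity)] at h4
  calc Psi (Real.exp (t - s)) y
      ≤ Psi (Real.exp (t - 4 * h * ⌊s / (4 * h)⌋₊)) y :=
        Psi_mono (Real.exp_le_exp.2 (by linarith))
    _ = Real.exp (-⌊s / (4 * h)⌋₊) *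
          (Real.exp ⌊s / (4 * h)⌋₊ * Psi (Real.exp (t - 4 * h * ⌊s / (4 * h)⌋₊)) y) := by
        rw [← mul_assoc, ← Real.exp_add, neg_add_cancel, Real.exp_zero, one_mul]
    _ ≤ Real.exp (1 - s / (4 * h)) * Psi (Real.exp t) y :=
        mul_le_mul (Real.exp_le_exp.2 (by linarith)) h3
          (mul_nonneg (Real.exp_pos _).le (Psi_nonneg _ _)) (Real.exp_pos _).le

/-- The primes at which the block of `n` has logarithmic size at least `a`. -/
def bigPrimes (n : ℕ) (a : ℝ) : Finset ℕ := n.primeFactors.filter fun p => a ≤ blk n p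

theorem card_bigPrimes_mul_le {n : ℕ} (hn : n ≠ 0) (a : ℝ) :
    (bigPrimes n a).card * a ≤ Real.log n := by
  rw [← sum_blk hn, ← nsmul_eq_mul, ← Finset.sum_const]
  exact (Finset.sum_le_sum fun p hp => (Finset.mem_filter.1 hp).2).trans
    (Finset.sum_le_sum_of_subset_of_nonneg (Finset.filter_subset _ _) fun p _ _ => blk_nonneg n p)

/-- Counting friable integers with at least `M` large prime-power blocks. -/
theorem card_many_bigPrimes_le {T h y : ℝ} (hy : 2 ≤ y) (hL : Real.log y ≤ h)
    (hT : T ≤ (primesUpTo y).card * h) (hT0 : 0 ≤ T) (M : ℕ) {A : ℝ} (hA : 2 ≤ A) :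
    (((Sf (Real.exp T) y).filter fun n => M ≤ (bigPrimes n (A * h)).card).card : ℝ) ≤
      (T / h) ^ M / M.factorial * Real.exp (1 - (A - 2) * M / 4) * Psi (Real.exp T) y := by
  have hLpos : 0 < Real.log y := Real.log_pos (by linarith)
  have hh : 0 < h := hLpos.trans_le hL
  set s : ℕ → ℕ := fun p => ⌊(A - 1) * h / Real.log p⌋₊ with hs
  have hsp : ∀ p : ℕ, p.Prime → (p : ℝ) ≤ y →
      (s p : ℝ) * Real.log p ≤ (A - 1) * h ∧ (A - 2) * h ≤ s p * Real.log p := by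
    intro p hp hpy
    have hl : 0 < Real.log p := Real.log_pos (by exact_mod_cast hp.one_lt)
    have hlL : Real.log p ≤ Real.log y := Real.log_le_log (by exact_mod_cast hp.pos) hpy
    have hA1 : 0 ≤ A - 1 := by linarith
    constructor
    · exact (le_div_iff₀ hl).1 (Nat.floor_le (by positivity))
    · have := Nat.lt_floor_add_one ((A - 1) * h / Real.log p)
      rw [div_lt_iff₀ hl] at this
      rw [hs]
      linarith
  set F := (Sf (Real.exp T) y).filter fun n => M ≤ (bigPrimes n (A * h)).card with hF
  have hex : ∀ n : ℕ, ∃ Q : Finset ℕ, n ∈ F → Q ⊆ bigPrimes n (A * h) ∧ Q.card = M := by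
    intro n
    by_cases hn : n ∈ F
    · obtain ⟨Q, h1, h2⟩ := Finset.exists_subset_card_eq (Finset.mem_filter.1 hn).2
      exact ⟨Q, fun _ => ⟨h1, h2⟩⟩
    · exact ⟨∅, fun h => absurd h hn⟩
  choose Q hQ using hex
  set D : Finset ℕ → ℕ := fun q => ∏ p ∈ q, p ^ s p with hD
  have hfac : ∀ q : Finset ℕ, (∀ p ∈ q, p.Prime) → ∀ p, (D q).factorization p =
      if p ∈ q then s p else 0 := by
    intro q hq p
    rw [hD]
    simp only
    rw [Nat.factorization_prod (fun i hi => pow_ne_zero _ (hq i hi).ne_zero), Finset.sum_apply']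
    have : ∀ i ∈ q, (i ^ s i).factorization p = if p = i then s p else 0 := by
      intro i hi
      rw [(hq i hi).factorization_pow, Finsupp.single_apply]
      by_cases hip : i = p
      · simp [hip]
      · simp [hip, Ne.symm hip]
    rw [Finset.sum_congr rfl this]
    simp
  have hQprop : ∀ n ∈ F, n ∈ Sf (Real.exp T) y ∧ (∀ p ∈ Q n, p.Prime ∧ (p:ℝ) ≤ y) ∧
      (∀ p ∈ Q n, A * h ≤ blk n p) ∧ (Q n).card = M := by
    intro n hn
    obtain ⟨h1, h2⟩ := hQ n hn
    have hnS := (Finset.mem_filter.1 hn).1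
    refine ⟨hnS, fun p hp => ?_, fun p hp => (Finset.mem_filter.1 (h1 hp)).2, h2⟩
    exact mem_primesUpTo.1 (primeFactors_subset_primesUpTo hnS (Finset.mem_filter.1 (h1 hp)).1)
  have hdvd : ∀ n ∈ F, D (Q n) ∣ n := by
    intro n hn
    obtain ⟨h1, h2, h3, h4⟩ := hQprop n hn
    have hDne : D (Q n) ≠ 0 :=
      Finset.prod_ne_zero_iff.2 fun p hp => pow_ne_zero _ (h2 p hp).1.ne_zero
    rw [← Nat.factorization_le_iff_dvd hDne (mem_Sf.1 h1).1]
    intro p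
    rw [hfac _ (fun p hp => (h2 p hp).1)]
    split_ifs with hp
    · have hl : 0 < Real.log p := Real.log_pos (by exact_mod_cast (h2 p hp).1.one_lt)
      have h5 := h3 p hp
      have h6 := (hsp p (h2 p hp).1 (h2 p hp).2).1
      rw [blk] at h5
      have : (s p : ℝ) * Real.log p ≤ (n.factorization p : ℝ) * Real.log p := by linarith
      exact_mod_cast le_of_mul_le_mul_right this hl
    · exact Nat.zero_le _
  have hmain : F.card ≤ ((Sf (Real.exp (T - (A - 2) * h * M)) y).sigma
      fun m => (bigPrimes m h).powersetCard M).card := by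
    refine Finset.card_le_card_of_injOn (fun n => ⟨n / D (Q n), Q n⟩) ?_ ?_
    · intro n hn
      have hn' : n ∈ F := hn
      obtain ⟨h1, h2, h3, h4⟩ := hQprop n hn'
      have hnS := mem_Sf.1 h1
      obtain ⟨m, hm⟩ := hdvd n hn'
      have hDne : D (Q n) ≠ 0 := fun h0 => hnS.1 (by rw [hm, h0, zero_mul])
      have hmne : m ≠ 0 := fun h0 => hnS.1 (by rw [hm, h0, mul_zero])
      have hdiv : n / D (Q n) = m := Nat.div_eq_of_eq_mul_right (Nat.pos_of_ne_zero hDne) hm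
      simp only [Finset.mem_coe, Finset.mem_sigma, hdiv]
      have hblk : ∀ p ∈ Q n, h ≤ blk m p := by
        intro p hp
        have h5 := h3 p hp
        have h6 := (hsp p (h2 p hp).1 (h2 p hp).2).1
        rw [hm, blk_mul hDne hmne] at h5
        have h7 : blk (D (Q n)) p = s p * Real.log p := by
          rw [blk, hfac _ (fun p hp => (h2 p hp).1), if_pos hp]
        rw [h7] at h5
        linarith
      refine ⟨mem_Sf.2 ⟨hmne, ?_, fun p hp hpm => hnS.2.2 p hp ?_⟩, ?_⟩
      · have hlogD : (A - 2) * h * M ≤ Real.log (D (Q n)) := by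
          have h8 : Real.log (D (Q n)) = ∑ p ∈ Q n, s p * Real.log p := by
            rw [hD]
            simp only
            rw [Nat.cast_prod, Real.log_prod]
            · exact Finset.sum_congr rfl fun p _ => by rw [Nat.cast_pow, Real.log_pow]
            · intro p hp
              exact_mod_cast pow_ne_zero _ (h2 p hp).1.ne_zero
          rw [h8, ← h4, mul_comm, ← nsmul_eq_mul, ← Finset.sum_const]
          exact Finset.sum_le_sum fun p hp => (hsp p (h2 p hp).1 (h2 p hp).2).2
        have h9 := log_le_of_mem_Sf h1
        have h10 : Real.log n = Real.log (D (Q n)) + Real.log m := by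
          conv_lhs => rw [hm]
          rw [Nat.cast_mul, Real.log_mul (by exact_mod_cast hDne) (by exact_mod_cast hmne)]
        rw [← Real.log_le_iff_le_exp (by exact_mod_cast Nat.pos_of_ne_zero hmne)]
        linarith
      · rw [hm]
        exact hpm.mul_left _
      · rw [Finset.mem_powersetCard]
        refine ⟨fun p hp => ?_, h4⟩
        have hb := hblk p hp
        refine Finset.mem_filter.2 ⟨?_, hb⟩
        by_contra hc
        rw [← Nat.support_factorization, Finsupp.notMem_support_iff] at hc
        rw [blk, hc, Nat.cast_zero, zero_mul] at hb
        linarith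
    · intro a ha b hb hab
      simp only [Sigma.mk.injEq, heq_eq_eq] at hab
      have h1 := Nat.div_mul_cancel (hdvd a ha)
      have h2 := Nat.div_mul_cancel (hdvd b hb)
      rw [← h1, ← h2, hab.1, hab.2]
  have hcard : (F.card : ℝ) ≤ ∑ m ∈ Sf (Real.exp (T - (A - 2) * h * M)) y,
      (T / h) ^ M / M.factorial := by
    refine (Nat.cast_le.2 hmain).trans ?_
    rw [Finset.card_sigma, Nat.cast_sum]
    refine Finset.sum_le_sum fun m hm => ?_
    rw [Finset.card_powersetCard]
    refine (Nat.choose_le_pow_div M _).trans ?_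
    have h1 := card_bigPrimes_mul_le (mem_Sf.1 hm).1 h
    have h2 := log_le_of_mem_Sf hm
    have h3 : 0 ≤ (A - 2) * h * M :=
      mul_nonneg (mul_nonneg (by linarith) hh.le) (Nat.cast_nonneg _)
    have h4 : ((bigPrimes m h).card : ℝ) ≤ T / h := by
      rw [le_div_iff₀ hh]
      linarith
    gcongr
  rw [Finset.sum_const, nsmul_eq_mul] at hcard
  have hdec := Psi_decay hy hL hT (s := (A - 2) * h * M)
    (mul_nonneg (mul_nonneg (by linarith) hh.le) (Nat.cast_nonneg _))
  rw [show (A - 2) * h * M / (4 * h) = (A - 2) * M / 4 by field_simp] at hdec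
  calc (F.card : ℝ) ≤ Psi (Real.exp (T - (A - 2) * h * M)) y * ((T / h) ^ M / M.factorial) := hcard
    _ ≤ (Real.exp (1 - (A - 2) * M / 4) * Psi (Real.exp T) y) *
          ((T / h) ^ M / M.factorial) :=
        mul_le_mul_of_nonneg_right hdec (by positivity)
    _ = _ := by ring

/-- A bound on each order statistic bounds the fourth moment. -/
theorem sum_pow_four_le_of_order_statistics {ι : Type*} (X : ι → ℝ) (hX : ∀ i, 0 ≤ X i) (g : ℕ → ℝ)
    (K : ℕ) : ∀ P : Finset ι, P.card ≤ K →
      (∀ j < K, (P.filter fun p => g (j + 1) ≤ X p).card < j + 1) →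
      ∑ p ∈ P, X p ^ 4 ≤ ∑ j ∈ Finset.range K, g (j + 1) ^ 4 := by
  have hnn : ∀ j, 0 ≤ g j ^ 4 := fun j => by positivity
  suffices H : ∀ c ≤ K, ∀ P : Finset ι, P.card = c →
      (∀ j < K, (P.filter fun p => g (j + 1) ≤ X p).card < j + 1) →
      ∑ p ∈ P, X p ^ 4 ≤ ∑ j ∈ Finset.range c, g (j + 1) ^ 4 by
    intro P hP h
    exact (H _ hP P rfl h).trans (Finset.sum_le_sum_of_subset_of_nonneg
      (Finset.range_subset_range.2 hP) fun i _ _ => hnn _)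
  intro c
  induction c with
  | zero =>
    intro _ P hP _
    rw [Finset.card_eq_zero.1 hP]
    simp
  | succ c ih =>
    intro hc P hP h
    have hex : ∃ p ∈ P, X p < g (c + 1) := by
      by_contra! hcon
      have := h c hc
      rw [Finset.filter_true_of_mem hcon, hP] at this
      exact lt_irrefl _ this
    obtain ⟨p, hp, hlt⟩ := hex
    rw [← Finset.sum_erase_add _ _ hp, Finset.sum_range_succ]
    refine add_le_add (ih (by omega) _ ?_ fun j hj => ?_) (pow_le_pow_left₀ (hX p) hlt.le 4)
    · rw [Finset.card_erase_of_mem hp, hP]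
      rfl
    · exact (Finset.card_le_card (Finset.filter_subset_filter _ (Finset.erase_subset _ _))).trans_lt
        (h j hj)

theorem add_add_pow_four_le (a b c : ℝ) :
    (a + b + c) ^ 4 ≤ 27 * (a ^ 4 + b ^ 4 + c ^ 4) := by
  have h : ∀ a b c : ℝ, (a + b + c) ^ 2 ≤ 3 * (a ^ 2 + b ^ 2 + c ^ 2) := fun a b c => by
    nlinarith [sq_nonneg (a - b), sq_nonneg (b - c), sq_nonneg (a - c)]
  calc (a + b + c) ^ 4 = ((a + b + c) ^ 2) ^ 2 := by ring
    _ ≤ (3 * (a ^ 2 + b ^ 2 + c ^ 2)) ^ 2 := pow_le_pow_left₀ (sq_nonneg _) (h a b c) 2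
    _ = 9 * (a ^ 2 + b ^ 2 + c ^ 2) ^ 2 := by ring
    _ ≤ 9 * (3 * ((a ^ 2) ^ 2 + (b ^ 2) ^ 2 + (c ^ 2) ^ 2)) :=
        mul_le_mul_of_nonneg_left (h _ _ _) (by norm_num)
    _ = _ := by ring

theorem sum_sqrt_div_le {U : ℝ} (hU : 0 ≤ U) {K : ℕ} (hK : (K : ℝ) ≤ U) :
    ∑ j ∈ Finset.range K, Real.sqrt (U / ((j + 1 : ℕ) : ℝ)) ≤ 2 * U := by
  have h : ∀ k : ℕ, ∑ j ∈ Finset.range k, Real.sqrt (1 / ((j + 1 : ℕ) : ℝ)) ≤ 2 * Real.sqrt k := by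
    intro k
    induction k with
    | zero => simp
    | succ k ih =>
      rw [Finset.sum_range_succ]
      set a := Real.sqrt k
      have hb : 0 < Real.sqrt ((k + 1 : ℕ) : ℝ) := Real.sqrt_pos.2 (by positivity)
      set b := Real.sqrt ((k + 1 : ℕ) : ℝ)
      have ha2 : a ^ 2 = k := Real.sq_sqrt (Nat.cast_nonneg _)
      have hb2 : b ^ 2 = k + 1 := by
        rw [Real.sq_sqrt (Nat.cast_nonneg _)]
        push_cast
        rfl
      have : Real.sqrt (1 / ((k + 1 : ℕ) : ℝ)) ≤ 2 * (b - a) := by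
        rw [Real.sqrt_div zero_le_one, Real.sqrt_one, div_le_iff₀ hb]
        nlinarith [sq_nonneg (b - a)]
      linarith
  calc ∑ j ∈ Finset.range K, Real.sqrt (U / ((j + 1 : ℕ) : ℝ))
      = Real.sqrt U * ∑ j ∈ Finset.range K, Real.sqrt (1 / ((j + 1 : ℕ) : ℝ)) := by
        rw [Finset.mul_sum]
        refine Finset.sum_congr rfl fun j _ => ?_
        rw [← Real.sqrt_mul hU, mul_one_div]
    _ ≤ Real.sqrt U * (2 * Real.sqrt U) := by
        refine mul_le_mul_of_nonneg_left ((h K).trans ?_) (Real.sqrt_nonneg _)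
        exact mul_le_mul_of_nonneg_left (Real.sqrt_le_sqrt hK) (by norm_num)
    _ = 2 * U := by
        rw [mul_left_comm, Real.mul_self_sqrt hU]

theorem sum_inv_pow_four_le (K : ℕ) :
    ∑ j ∈ Finset.range K, (1 / ((j + 1 : ℕ) : ℝ)) ^ 4 ≤ 2 := by
  have h : ∀ k : ℕ, ∑ j ∈ Finset.range k, (1 / ((j + 1 : ℕ) : ℝ)) ^ 4 ≤ 2 - 1 / ((k + 1 : ℕ) : ℝ) := by
    intro k
    induction k with
    | zero => norm_num
    | succ k ih =>
      rw [Finset.sum_range_succ]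
      have hk : (0:ℝ) < k + 1 := by positivity
      have : (1 / ((k + 1 : ℕ) : ℝ)) ^ 4 ≤ 1 / ((k + 1 : ℕ) : ℝ) - 1 / ((k + 1 + 1 : ℕ) : ℝ) ∨ k = 0 := by
        rcases Nat.eq_zero_or_pos k with h0 | h0
        · exact Or.inr h0
        left
        have hk1 : (1:ℝ) ≤ k := by exact_mod_cast h0
        push_cast
        rw [div_sub_div _ _ (by positivity) (by positivity), div_pow, div_le_div_iff₀ (by positivity)
          (by positivity)]
        have : (k:ℝ) + 2 ≤ (k + 1) ^ 2 := by nlinarith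
        have h2 : 0 < ((k:ℝ) + 1) ^ 2 := by positivity
        nlinarith [mul_le_mul_of_nonneg_left this h2.le, mul_pos h2 hk]
      rcases this with h1 | h0
      · linarith
      · subst h0
        norm_num
  have := h K
  have h2 : 0 ≤ 1 / ((K + 1 : ℕ) : ℝ) := by positivity
  linarith

theorem log_pow_four_le {t : ℝ} (ht : 1 ≤ t) : Real.log t ^ 4 ≤ 4096 * Real.sqrt t := by
  have h0 : 0 ≤ t := by linarith
  have h1 := Real.log_le_rpow_div h0 (ε := 1 / 8) (by norm_num)
  calc Real.log t ^ 4 ≤ (t ^ (1 / 8 : ℝ) / (1 / 8)) ^ 4 :=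
        pow_le_pow_left₀ (Real.log_nonneg ht) h1 4
    _ = 4096 * (t ^ (1 / 8 : ℝ)) ^ 4 := by ring
    _ = 4096 * Real.sqrt t := by
        rw [← Real.rpow_natCast, ← Real.rpow_mul h0, Real.sqrt_eq_rpow]
        norm_num

/-- The threshold for the `M`-th largest block. -/
def thr (U B : ℝ) (M : ℕ) : ℝ := 10 + 4 * Real.log (U / M) + 4 * B / M

theorem sum_thr_pow_four_le {U B : ℝ} (hU : 0 ≤ U) {K : ℕ} (hK : (K : ℝ) ≤ U) :
    ∑ j ∈ Finset.range K, thr U B (j + 1) ^ 4 ≤ 57000000 * U + 14000 * B ^ 4 := by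
  have h1 : ∀ j ∈ Finset.range K, thr U B (j + 1) ^ 4 ≤
      270000 + 28311552 * Real.sqrt (U / ((j + 1 : ℕ) : ℝ)) +
        6912 * B ^ 4 * (1 / ((j + 1 : ℕ) : ℝ)) ^ 4 := by
    intro j hj
    have hjU : ((j + 1 : ℕ) : ℝ) ≤ U := (Nat.cast_le.2 (Finset.mem_range.1 hj)).trans hK
    have hjp : (0:ℝ) < ((j + 1 : ℕ) : ℝ) := by positivity
    have h2 := log_pow_four_le ((one_le_div hjp).2 hjU)
    refine (add_add_pow_four_le _ _ _).trans ?_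
    rw [mul_pow, div_pow, one_div_pow, mul_pow]
    have : 4 ^ 4 * B ^ 4 / ((j + 1 : ℕ) : ℝ) ^ 4 = 256 * (B ^ 4 * (1 / ((j + 1 : ℕ) : ℝ) ^ 4)) := by
      ring
    rw [this]
    linarith
  refine (Finset.sum_le_sum h1).trans ?_
  rw [Finset.sum_add_distrib, Finset.sum_add_distrib, ← Finset.mul_sum, ← Finset.mul_sum]
  have h3 := sum_sqrt_div_le hU hK
  have h4 := sum_inv_pow_four_le K
  have hB : 0 ≤ B ^ 4 := by positivity
  have h5 := mul_le_mul_of_nonneg_left h4 hB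
  simp only [Finset.sum_const, Finset.card_range, nsmul_eq_mul]
  linarith

theorem pow_div_factorial_le {U : ℝ} {M : ℕ} (hM : 0 < M) (hU : 0 < U) :
    U ^ M / M.factorial ≤ Real.exp (M + M * Real.log (U / M)) := by
  have hMp : (0:ℝ) < M := by exact_mod_cast hM
  have h1 := Real.pow_div_factorial_le_exp (M:ℝ) hMp.le M
  rw [Real.exp_add, mul_comm (M:ℝ) (Real.log _), ← Real.rpow_def_of_pos (by positivity),
    Real.rpow_natCast, div_pow]
  calc U ^ M / M.factorial = ((M:ℝ) ^ M / M.factorial) * (U ^ M / (M:ℝ) ^ M) := by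
        field_simp
    _ ≤ _ := mul_le_mul_of_nonneg_right h1 (by positivity)

theorem sum_exp_neg_le (K : ℕ) : ∑ j ∈ Finset.range K, Real.exp (-((j + 1 : ℕ) : ℝ)) ≤ 1 := by
  have h : ∀ k : ℕ, ∑ j ∈ Finset.range k, Real.exp (-((j + 1 : ℕ) : ℝ)) ≤ 1 - Real.exp (-(k:ℝ)) := by
    intro k
    induction k with
    | zero => simp
    | succ k ih =>
      rw [Finset.sum_range_succ]
      have h2 : Real.exp (-(k:ℝ)) = Real.exp 1 * Real.exp (-((k + 1 : ℕ):ℝ)) := by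
        rw [← Real.exp_add]
        push_cast
        ring_nf
      have h3 : 2 ≤ Real.exp 1 := by
        have := Real.add_one_le_exp (1:ℝ)
        linarith
      have h4 := mul_le_mul_of_nonneg_right h3 (Real.exp_pos (-((k + 1 : ℕ):ℝ))).le
      linarith
  exact (h K).trans (by linarith [Real.exp_pos (-(K:ℝ))])

/-- The fourth moment of the blocks is rarely large. -/
theorem card_fourth_moment_gt_le {T h y B : ℝ} (hy : 2 ≤ y) (hL : Real.log y ≤ h)
    (hT : T ≤ (primesUpTo y).card * h) (hT0 : 0 ≤ T) (hB : 0 ≤ B) :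
    (((Sf (Real.exp T) y).filter fun n =>
      57000001 * (T / h) + 14000 * B ^ 4 < ∑ p ∈ n.primeFactors, (blk n p / h) ^ 4).card : ℝ) ≤
      Real.exp (1 - B) * Psi (Real.exp T) y := by
  have hLpos : 0 < Real.log y := Real.log_pos (by linarith)
  have hh : 0 < h := hLpos.trans_le hL
  set U := T / h with hUdef
  have hU : 0 ≤ U := by positivity
  set K := ⌊U⌋₊ with hKdef
  have hK : (K : ℝ) ≤ U := Nat.floor_le hU
  have hsub : ((Sf (Real.exp T) y).filter fun n =>
      57000001 * U + 14000 * B ^ 4 < ∑ p ∈ n.primeFactors, (blk n p / h) ^ 4) ⊆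
      (Finset.range K).biUnion fun j => (Sf (Real.exp T) y).filter fun n =>
        j + 1 ≤ (bigPrimes n (thr U B (j + 1) * h)).card := by
    intro n hn
    rw [Finset.mem_filter] at hn
    obtain ⟨hnS, hlt⟩ := hn
    by_contra hcon
    simp only [Finset.mem_biUnion, Finset.mem_filter, Finset.mem_range, not_exists, not_and,
      not_le] at hcon
    have hn0 := (mem_Sf.1 hnS).1
    have hlog := log_le_of_mem_Sf hnS
    have hXnn : ∀ p, 0 ≤ blk n p / h := fun p => div_nonneg (blk_nonneg n p) hh.le
    have hbig : ∑ p ∈ bigPrimes n h, (blk n p / h) ^ 4 ≤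
        ∑ j ∈ Finset.range K, thr U B (j + 1) ^ 4 := by
      refine sum_pow_four_le_of_order_statistics _ hXnn (thr U B) K _ ?_ ?_
      · refine Nat.le_floor ?_
        rw [hUdef, le_div_iff₀ hh]
        exact (card_bigPrimes_mul_le hn0 h).trans hlog
      · intro j hj
        refine lt_of_le_of_lt (Finset.card_le_card fun p hp => ?_) (hcon j hj hnS)
        rw [Finset.mem_filter] at hp
        exact Finset.mem_filter.2 ⟨(Finset.mem_filter.1 hp.1).1, (le_div_iff₀ hh).1 hp.2⟩
    have hsmall : ∑ p ∈ n.primeFactors.filter (fun p => ¬ h ≤ blk n p), (blk n p / h) ^ 4 ≤ U := by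
      calc _ ≤ ∑ p ∈ n.primeFactors.filter (fun p => ¬ h ≤ blk n p), blk n p / h := by
            refine Finset.sum_le_sum fun p hp => ?_
            have h1 : blk n p / h ≤ 1 :=
              (div_le_one hh).2 (not_le.1 (Finset.mem_filter.1 hp).2).le
            exact pow_le_of_le_one (hXnn p) h1 (by norm_num)
        _ ≤ ∑ p ∈ n.primeFactors, blk n p / h :=
            Finset.sum_le_sum_of_subset_of_nonneg (Finset.filter_subset _ _) fun p _ _ => hXnn p
        _ ≤ U := by
            rw [← Finset.sum_div, sum_blk hn0]
            exact div_le_div_of_nonneg_right hlog hh.le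
    have hsplit := Finset.sum_filter_add_sum_filter_not n.primeFactors (fun p => h ≤ blk n p)
      (fun p => (blk n p / h) ^ 4)
    have hthr := sum_thr_pow_four_le (B := B) hU hK
    rw [bigPrimes] at hbig
    linarith
  have hterm : ∀ j ∈ Finset.range K, (((Sf (Real.exp T) y).filter fun n =>
        j + 1 ≤ (bigPrimes n (thr U B (j + 1) * h)).card).card : ℝ) ≤
      Real.exp (-((j + 1 : ℕ) : ℝ)) * (Real.exp (1 - B) * Psi (Real.exp T) y) := by
    intro j hj
    have hjU : ((j + 1 : ℕ) : ℝ) ≤ U := (Nat.cast_le.2 (Finset.mem_range.1 hj)).trans hK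
    have hjp : (0:ℝ) < ((j + 1 : ℕ) : ℝ) := by positivity
    have hlog : 0 ≤ Real.log (U / ((j + 1 : ℕ) : ℝ)) := Real.log_nonneg ((one_le_div hjp).2 hjU)
    have hBj : 0 ≤ 4 * B / ((j + 1 : ℕ) : ℝ) := by positivity
    refine (card_many_bigPrimes_le hy hL hT hT0 (j + 1) (A := thr U B (j + 1))
      (by rw [thr]; linarith)).trans ?_
    have h1 := pow_div_factorial_le (Nat.succ_pos j) (hjp.trans_le hjU)
    rw [← mul_assoc, ← Real.exp_add]
    refine mul_le_mul_of_nonneg_right ?_ (Psi_nonneg _ _)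
    refine (mul_le_mul_of_nonneg_right h1 (Real.exp_pos _).le).trans ?_
    rw [← Real.exp_add]
    refine Real.exp_le_exp.2 (le_of_eq ?_)
    rw [thr, Nat.succ_eq_add_one]
    field_simp
    ring
  calc _ ≤ (((Finset.range K).biUnion fun j => (Sf (Real.exp T) y).filter fun n =>
        j + 1 ≤ (bigPrimes n (thr U B (j + 1) * h)).card).card : ℝ) :=
        Nat.cast_le.2 (Finset.card_le_card hsub)
    _ ≤ ∑ j ∈ Finset.range K, (((Sf (Real.exp T) y).filter fun n =>
        j + 1 ≤ (bigPrimes n (thr U B (j + 1) * h)).card).card : ℝ) := by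
        exact_mod_cast Finset.card_biUnion_le
    _ ≤ _ := Finset.sum_le_sum hterm
    _ ≤ 1 * (Real.exp (1 - B) * Psi (Real.exp T) y) := by
        rw [← Finset.sum_mul]
        exact mul_le_mul_of_nonneg_right (sum_exp_neg_le K)
          (mul_nonneg (Real.exp_pos _).le (Psi_nonneg _ _))
    _ = _ := one_mul _

theorem log_factorial_eq_sum (N : ℕ) :
    ∑ p ∈ primesUpTo N, blk N.factorial p = Real.log N.factorial := by
  refine sum_blk_of_subset N.factorial_ne_zero fun p hp => ?_
  have hp' := Nat.mem_primeFactors.1 hp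
  exact mem_primesUpTo.2 ⟨hp'.1, by exact_mod_cast (hp'.1.dvd_factorial).1 hp'.2.1⟩

theorem div_le_two_mul_factorization_factorial {N p : ℕ} (hp : p.Prime) (hpN : p ≤ N) :
    (N : ℝ) / p ≤ 2 * (N.factorial.factorization p : ℝ) := by
  have h1 : N / p ≤ N.factorial.factorization p := by
    rw [Nat.factorization_factorial hp (Nat.lt_succ_self _)]
    have h1mem : 1 ∈ Finset.Ico 1 (Nat.log p N).succ :=
      Finset.mem_Ico.2 ⟨le_rfl, Nat.lt_succ_of_le (Nat.log_pos hp.one_lt hpN)⟩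
    calc N / p = N / p ^ 1 := by rw [pow_one]
      _ ≤ _ := Finset.single_le_sum (f := fun i => N / p ^ i) (fun _ _ => Nat.zero_le _) h1mem
  have h2 : (N:ℝ) / p ≤ 2 * ((N / p : ℕ) : ℝ) := by
    have hpp : (0:ℝ) < p := by exact_mod_cast hp.pos
    rw [div_le_iff₀ hpp]
    have h3 := Nat.div_add_mod N p
    have h4 := Nat.mod_lt N hp.pos
    have h5 : 1 ≤ N / p := (Nat.one_le_div_iff hp.pos).2 hpN
    have h6 : p ≤ p * (N / p) := Nat.le_mul_of_pos_right p h5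
    have h7 : N ≤ 2 * (N / p) * p := by
      rw [mul_assoc, mul_comm (N / p) p]
      omega
    exact_mod_cast h7
  have h3 : ((N / p : ℕ) : ℝ) ≤ (N.factorial.factorization p : ℝ) := Nat.cast_le.2 h1
  linarith

theorem primesUpTo_floor (y : ℝ) : primesUpTo (⌊y⌋₊ : ℝ) = primesUpTo y := by
  unfold primesUpTo
  rw [Nat.floor_natCast]

theorem sum_log_div_le {y : ℝ} (hy : 1 ≤ y) :
    ∑ p ∈ primesUpTo y, Real.log p / p ≤ 2 * Real.log y := by
  rw [← primesUpTo_floor]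
  set N := ⌊y⌋₊ with hN
  have hN1 : 1 ≤ N := Nat.le_floor (by simpa using hy)
  have hNpos : (0:ℝ) < N := by exact_mod_cast hN1
  have hNy : (N:ℝ) ≤ y := Nat.floor_le (by linarith)
  have h1 : ∑ p ∈ primesUpTo (N:ℝ), (N : ℝ) * (Real.log p / p) ≤
      ∑ p ∈ primesUpTo (N:ℝ), 2 * blk N.factorial p := by
    refine Finset.sum_le_sum fun p hp => ?_
    obtain ⟨hp, hpN⟩ := mem_primesUpTo.1 hp
    have h := div_le_two_mul_factorization_factorial hp (by exact_mod_cast hpN : p ≤ N)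
    have := mul_le_mul_of_nonneg_right h (Real.log_natCast_nonneg p)
    rw [blk]
    calc (N:ℝ) * (Real.log p / p) = N / p * Real.log p := by ring
      _ ≤ _ := by linarith
  rw [← Finset.mul_sum, ← Finset.mul_sum, log_factorial_eq_sum] at h1
  have h2 : Real.log N.factorial ≤ N * Real.log N := by
    rw [← Real.log_pow]
    exact Real.log_le_log (by exact_mod_cast N.factorial_pos) (by exact_mod_cast N.factorial_le_pow)
  have h3 : Real.log N ≤ Real.log y := Real.log_le_log hNpos hNy
  have h4 : (N:ℝ) * ∑ p ∈ primesUpTo (N:ℝ), Real.log p / p ≤ N * (2 * Real.log N) := by linarith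
  exact (le_of_mul_le_mul_left h4 hNpos).trans (by linarith)

theorem exists_le_sum_log_div :
    ∃ C₁ > (0:ℝ), ∀ y : ℝ, 1 ≤ y → Real.log y - C₁ ≤ ∑ p ∈ primesUpTo y, Real.log p / p := by
  have hsum : Summable fun n : ℕ => 1 / (n : ℝ) ^ (3 / 2 : ℝ) :=
    Real.summable_one_div_nat_rpow.2 (by norm_num)
  set S := ∑' n : ℕ, 1 / (n : ℝ) ^ (3 / 2 : ℝ) with hS
  have hS0 : 0 ≤ S := tsum_nonneg fun n => by positivity
  refine ⟨4 * S + 2, by positivity, fun y hy => ?_⟩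
  rw [← primesUpTo_floor]
  set N := ⌊y⌋₊ with hN
  have hN1 : 1 ≤ N := Nat.le_floor (by simpa using hy)
  have hNpos : (0:ℝ) < N := by exact_mod_cast hN1
  have hyN : y ≤ 2 * N := by
    have : y < N + 1 := Nat.lt_floor_add_one y
    have : (1:ℝ) ≤ N := by exact_mod_cast hN1
    linarith
  have h1 : ∑ p ∈ primesUpTo (N:ℝ), blk N.factorial p ≤
      ∑ p ∈ primesUpTo (N:ℝ), (N : ℝ) * (Real.log p / p + 4 * (1 / (p : ℝ) ^ (3 / 2 : ℝ))) := by
    refine Finset.sum_le_sum fun p hp => ?_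
    obtain ⟨hp, hpN⟩ := mem_primesUpTo.1 hp
    have hp2 : (2:ℝ) ≤ p := by exact_mod_cast hp.two_le
    have := Fact.mk hp
    have h2 : (p - 1) * N.factorial.factorization p ≤ N := by
      rw [Nat.factorization_def _ hp, sub_one_mul_padicValNat_factorial]
      exact Nat.sub_le _ _
    have h3 : ((p:ℝ) - 1) * (N.factorial.factorization p : ℝ) ≤ N := by
      have : (((p - 1 : ℕ) : ℝ)) * (N.factorial.factorization p : ℝ) ≤ N := by exact_mod_cast h2
      rwa [Nat.cast_sub hp.one_le, Nat.cast_one] at this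
    have h4 : Real.log p ≤ 2 * (p:ℝ) ^ (1 / 2 : ℝ) := by
      have := Real.log_le_rpow_div (by linarith : (0:ℝ) ≤ p) (ε := 1 / 2) (by norm_num)
      linarith
    have hl := Real.log_natCast_nonneg p
    have h5 : (N.factorial.factorization p : ℝ) ≤ N / ((p:ℝ) - 1) := by
      rw [le_div_iff₀ (by linarith)]
      linarith
    have h6 : (p:ℝ) ^ (3 / 2 : ℝ) * (p:ℝ) ^ (1 / 2 : ℝ) = (p:ℝ) ^ 2 := by
      rw [← Real.rpow_add (by linarith), ← Real.rpow_natCast]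
      norm_num
    have h7 : Real.log p / ((p:ℝ) - 1) ≤ Real.log p / p + 4 * (1 / (p : ℝ) ^ (3 / 2 : ℝ)) := by
      have h8 : Real.log p / ((p:ℝ) - 1) = Real.log p / p + Real.log p / (p * (p - 1)) := by
        have : (p:ℝ) - 1 ≠ 0 := by linarith
        field_simp
        ring
      rw [h8]
      have h9 : Real.log p / (p * ((p:ℝ) - 1)) ≤ 4 * (1 / (p : ℝ) ^ (3 / 2 : ℝ)) := by
        have hr : 0 < (p:ℝ) ^ (3 / 2 : ℝ) := by positivity
        rw [mul_one_div, div_le_div_iff₀ (by nlinarith) hr]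
        have := mul_le_mul_of_nonneg_right h4 hr.le
        nlinarith
      linarith
    calc blk N.factorial p ≤ N / ((p:ℝ) - 1) * Real.log p := mul_le_mul_of_nonneg_right h5 hl
      _ = N * (Real.log p / ((p:ℝ) - 1)) := by ring
      _ ≤ _ := mul_le_mul_of_nonneg_left h7 hNpos.le
  rw [← Finset.mul_sum, log_factorial_eq_sum, Finset.sum_add_distrib, ← Finset.mul_sum] at h1
  have h2 : ∑ p ∈ primesUpTo (N:ℝ), 1 / (p : ℝ) ^ (3 / 2 : ℝ) ≤ S :=
    hsum.sum_le_tsum _ fun n _ => by positivity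
  have h3 : N * Real.log N - N ≤ Real.log N.factorial := by
    have h := Real.pow_div_factorial_le_exp (N:ℝ) hNpos.le N
    have hf : (0:ℝ) < N.factorial := by exact_mod_cast N.factorial_pos
    have h' := Real.log_le_log (by positivity) h
    rw [Real.log_exp, Real.log_div (by positivity) hf.ne', Real.log_pow] at h'
    linarith
  have h4 : Real.log y ≤ Real.log N + 1 := by
    have h := Real.log_le_log (by linarith) hyN
    rw [Real.log_mul two_ne_zero hNpos.ne'] at h
    linarith [Real.log_two_lt_d9]
  have h5 : (N:ℝ) * (Real.log N - 1) ≤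
      N * (∑ p ∈ primesUpTo (N:ℝ), Real.log p / p + 4 * ∑ p ∈ primesUpTo (N:ℝ), 1 / (p : ℝ) ^ (3 / 2 : ℝ)) := by
    linarith
  have h6 := le_of_mul_le_mul_left h5 hNpos
  linarith

theorem exists_sum_log_div_large_primes :
    ∃ L₁ > (0:ℝ), ∀ y : ℝ, 1 ≤ y → L₁ ≤ Real.log y →
      Real.log y / 2 ≤ ∑ p ∈ (primesUpTo y).filter (fun p : ℕ => Real.log y / 8 < Real.log p),
        Real.log p / p := by
  obtain ⟨C₁, hC₁, hC⟩ := exists_le_sum_log_div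
  refine ⟨4 * C₁, by positivity, fun y hy hL => ?_⟩
  have h1 := hC y hy
  have h2 := Finset.sum_filter_add_sum_filter_not (primesUpTo y)
    (fun p : ℕ => Real.log y / 8 < Real.log p) (fun p : ℕ => Real.log p / (p:ℝ))
  have h3 : ∑ p ∈ (primesUpTo y).filter (fun p : ℕ => ¬ Real.log y / 8 < Real.log p),
      Real.log p / (p:ℝ) ≤ 2 * (Real.log y / 8) := by
    have h4 := sum_log_div_le (y := Real.exp (Real.log y / 8))
      (Real.one_le_exp (by have := Real.log_nonneg hy; positivity))
    rw [Real.log_exp] at h4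
    refine le_trans (Finset.sum_le_sum_of_subset_of_nonneg (fun p hp => ?_) fun p _ _ =>
      div_nonneg (Real.log_natCast_nonneg p) (Nat.cast_nonneg _)) h4
    rw [Finset.mem_filter, not_lt] at hp
    have hpp := (mem_primesUpTo.1 hp.1).1
    exact mem_primesUpTo.2 ⟨hpp,
      (Real.log_le_iff_le_exp (by exact_mod_cast hpp.pos)).1 hp.2⟩
  linarith

/-- A crude lower bound for `Ψ(x, y)`, uniform in `y`. -/
theorem exists_le_Psi :
    ∃ L₁ > (0:ℝ), ∀ y : ℝ, 2 ≤ y → L₁ ≤ Real.log y → ∀ u : ℝ, 1 ≤ u →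
      Real.exp (u * Real.log y) / 2 * Real.exp (-(8 * u * Real.log (2 * u))) ≤
        Psi (Real.exp (u * Real.log y)) y := by
  obtain ⟨L₁, hL₁, hP⟩ := exists_sum_log_div_large_primes
  refine ⟨L₁, hL₁, fun y hy hL u hu => ?_⟩
  have hLpos : 0 < Real.log y := Real.log_pos (by linarith)
  have hy0 : 0 < y := by linarith
  have key : ∀ m : ℕ, ∀ t : ℝ, 0 ≤ t → t ≤ u * Real.log y → t ≤ (1 + m / 8) * Real.log y →
      Real.exp t / 2 * (1 / (2 * u)) ^ m ≤ Psi (Real.exp t) y := by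
    intro m
    induction m with
    | zero =>
      intro t ht0 _ ht
      have hty : Real.exp t ≤ y := by
        rw [← Real.le_log_iff_exp_le hy0]
        simpa using ht
      have h1 : 1 ≤ Real.exp t := Real.one_le_exp ht0
      have hSf : Sf (Real.exp t) y = Finset.Icc 1 ⌊Real.exp t⌋₊ := by
        refine Finset.filter_true_of_mem fun n hn p hp hpn => ?_
        have h2 := Finset.mem_Icc.1 hn
        have h3 : (n:ℝ) ≤ Real.exp t := (Nat.le_floor_iff' (by omega)).1 h2.2
        have h4 : (p:ℝ) ≤ n := by exact_mod_cast Nat.le_of_dvd (by omega) hpn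
        linarith
      rw [Psi, hSf, Nat.card_Icc, pow_zero, mul_one, Nat.add_sub_cancel]
      have h5 := Nat.lt_floor_add_one (Real.exp t)
      have h6 : (1:ℝ) ≤ (⌊Real.exp t⌋₊ : ℝ) := by
        exact_mod_cast Nat.le_floor (by simpa using h1)
      linarith
    | succ m ih =>
      intro t ht0 htu ht
      by_cases hcase : t ≤ (1 + m / 8) * Real.log y
      · refine le_trans ?_ (ih t ht0 htu hcase)
        refine mul_le_mul_of_nonneg_left ?_ (by positivity)
        refine pow_le_pow_of_le_one (by positivity) ?_ (Nat.le_succ m)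
        rw [div_le_one (by positivity)]
        linarith
      rw [not_le] at hcase
      have htL : Real.log y ≤ t := by
        have : 0 ≤ (m:ℝ) / 8 * Real.log y := by positivity
        linarith
      have htpos : 0 < t := by linarith
      set W := (primesUpTo y).filter (fun p : ℕ => Real.log y / 8 < Real.log p) with hW
      have h1 : ∑ p ∈ W, Real.log p * (Real.exp t / p / 2 * (1 / (2 * u)) ^ m) ≤
          t * Psi (Real.exp t) y := by
        refine le_trans ?_ sum_primes_le
        refine le_trans (Finset.sum_le_sum fun p hp => ?_)
          (Finset.sum_le_sum_of_subset_of_nonneg (Finset.filter_subset _ _) fun p _ _ =>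
            mul_nonneg (Real.log_natCast_nonneg p) (Finset.sum_nonneg fun _ _ => Nat.cast_nonneg _))
        rw [Finset.mem_filter] at hp
        obtain ⟨hpp, hpy⟩ := mem_primesUpTo.1 hp.1
        have hpp0 : (0:ℝ) < p := by exact_mod_cast hpp.pos
        have hply : Real.log p ≤ Real.log y := Real.log_le_log hpp0 hpy
        refine mul_le_mul_of_nonneg_left ?_ (Real.log_natCast_nonneg p)
        have h2 := mul_Psi_le_sum_factorization (t := t) (s := Real.log p) hpp hpy 1 (by simp)
        rw [Nat.cast_one, one_mul] at h2
        refine le_trans ?_ h2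
        have h3 := ih (t - Real.log p) (by linarith)
          (by linarith [Real.log_natCast_nonneg p]) (by
            push_cast at ht
            linarith)
        have h4 : Real.exp (t - Real.log p) = Real.exp t / p := by
          rw [Real.exp_sub, Real.exp_log hpp0]
        calc Real.exp t / p / 2 * (1 / (2 * u)) ^ m
            = Real.exp (t - Real.log p) / 2 * (1 / (2 * u)) ^ m := by rw [h4]
          _ ≤ _ := h3
      have h2 : ∑ p ∈ W, Real.log p * (Real.exp t / p / 2 * (1 / (2 * u)) ^ m) =
          (∑ p ∈ W, Real.log p / p) * (Real.exp t / 2 * (1 / (2 * u)) ^ m) := by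
        rw [Finset.sum_mul]
        exact Finset.sum_congr rfl fun p _ => by ring
      rw [h2] at h1
      have h3 : Real.log y / 2 * (Real.exp t / 2 * (1 / (2 * u)) ^ m) ≤
          u * Real.log y * Psi (Real.exp t) y :=
        (mul_le_mul_of_nonneg_right (hP y (by linarith) hL) (by positivity)).trans
          (h1.trans (mul_le_mul_of_nonneg_right htu (Psi_nonneg _ _)))
      have h4 : u * Real.log y * (Real.exp t / 2 * (1 / (2 * u)) ^ (m + 1)) ≤
          u * Real.log y * Psi (Real.exp t) y := by
        refine le_trans (le_of_eq ?_) h3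
        rw [pow_succ]
        field_simp
      exact le_of_mul_le_mul_left h4 (by positivity)
  have hceil : (⌈8 * (u - 1)⌉₊ : ℝ) < 8 * (u - 1) + 1 := Nat.ceil_lt_add_one (by linarith)
  have h1 := key ⌈8 * (u - 1)⌉₊ (u * Real.log y) (by positivity) le_rfl (by
    have := Nat.le_ceil (8 * (u - 1))
    exact mul_le_mul_of_nonneg_right (by linarith) hLpos.le)
  refine le_trans (mul_le_mul_of_nonneg_left ?_ (by positivity)) h1
  have h2 : 0 ≤ Real.log (2 * u) := Real.log_nonneg (by linarith)
  have h3 : (1 / (2 * u)) = Real.exp (-Real.log (2 * u)) := by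
    rw [Real.exp_neg, Real.exp_log (by linarith), one_div]
  rw [h3, ← Real.exp_nat_mul]
  refine Real.exp_le_exp.2 ?_
  have := mul_le_mul_of_nonneg_right (show (⌈8 * (u - 1)⌉₊ : ℝ) ≤ 8 * u by linarith) h2
  linarith

theorem sum_Sf_le_prod {f : ℕ →* ℝ} (hf : ∀ n, 0 ≤ f n) (hf1 : ∀ p : ℕ, p.Prime → f p < 1)
    (x y : ℝ) : ∑ n ∈ Sf x y, f n ≤ ∏ p ∈ primesUpTo y, (1 - f p)⁻¹ := by
  have h := (EulerProduct.summable_and_hasSum_smoothNumbers_prod_primesBelow_geometric (f := f)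
    (fun {p} hp => by rw [Real.norm_of_nonneg (hf p)]; exact hf1 p hp) (⌊y⌋₊ + 1)).2
  have h1 : ∑ n ∈ Sf x y, f n =
      ∑ n ∈ (Sf x y).subtype (· ∈ (⌊y⌋₊ + 1).smoothNumbers), f (n : ℕ) := by
    rw [Finset.sum_subtype_of_mem (fun n => f n)]
    intro n hn
    rw [Nat.mem_smoothNumbers']
    intro p hp hpn
    exact Nat.lt_succ_of_le (Nat.le_floor ((mem_Sf.1 hn).2.2 p hp hpn))
  rw [h1]
  exact sum_le_hasSum _ (fun n _ => hf n) h

theorem exists_prod_zeta_factor_le :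
    ∃ L₂ > 0, ∀ y : ℝ, 2 ≤ y → L₂ ≤ Real.log y →
      ∏ p ∈ primesUpTo y, (1 - Real.exp (-(Real.log p / Real.log y)) / p)⁻¹ ≤
        2 * Real.log y := by
  have h := (tendsto_order.1 tendsto_sub_mul_tsum_nat_rpow).2 2 one_lt_two
  rw [Filter.Eventually, mem_nhdsGT_iff_exists_Ioo_subset] at h
  obtain ⟨s, hs, h⟩ := h
  rw [Set.mem_Ioi] at hs
  refine ⟨2 / (s - 1), by have := sub_pos.2 hs; positivity, fun y hy hL => ?_⟩
  have hL0 : 0 < Real.log y := Real.log_pos (by linarith)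
  set σ : ℝ := 1 + 1 / Real.log y with hσ
  have hσ1 : 1 < σ := by have : 0 < 1 / Real.log y := by positivity
                         linarith
  have h1 : (σ - 1) * ∑' n : ℕ, 1 / (n : ℝ) ^ σ < 2 := by
    refine h ⟨hσ1, ?_⟩
    rw [div_le_iff₀ (sub_pos.2 hs)] at hL
    have : 1 / Real.log y < s - 1 := by
      rw [div_lt_iff₀ hL0]
      linarith
    linarith
  have h2 : ∑' n : ℕ, 1 / (n : ℝ) ^ σ ≤ 2 * Real.log y := by
    have h3 : σ - 1 = 1 / Real.log y := by rw [hσ]; ring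
    rw [h3, one_div, ← div_eq_inv_mul, div_lt_iff₀ hL0] at h1
    exact h1.le
  let g : ℕ →* ℝ :=
    { toFun := fun n => (n : ℝ) ^ (-σ)
      map_one' := by simp
      map_mul' := fun a b => by
        rw [Nat.cast_mul, Real.mul_rpow (Nat.cast_nonneg a) (Nat.cast_nonneg b)] }
  have hg : ∀ n, g n = (n : ℝ) ^ (-σ) := fun n => rfl
  have hgp : ∀ p : ℕ, p.Prime → g p = Real.exp (-(Real.log p / Real.log y)) / p := fun p hp => by
    have hp0 : (0 : ℝ) < p := by exact_mod_cast hp.pos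
    rw [hg, Real.rpow_def_of_pos hp0, hσ]
    have h3 : Real.log p * -(1 + 1 / Real.log y) = -(Real.log p / Real.log y) - Real.log p := by
      ring
    rw [h3, Real.exp_sub, Real.exp_log hp0]
  have h0 : ∀ n, 0 ≤ g n := fun n => Real.rpow_nonneg (Nat.cast_nonneg n) _
  have hlt : ∀ p : ℕ, p.Prime → g p < 1 := fun p hp =>
    Real.rpow_lt_one_of_one_lt_of_neg (by exact_mod_cast hp.one_lt) (by linarith)
  have hE := (EulerProduct.summable_and_hasSum_smoothNumbers_prod_primesBelow_geometric (f := g)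
    (fun {p} hp => by rw [Real.norm_of_nonneg (h0 p)]; exact hlt p hp) (⌊y⌋₊ + 1)).2
  have hS : Summable fun n : ℕ => g n := by
    simpa only [hg] using Real.summable_nat_rpow.2 (show -σ < -1 by linarith)
  calc ∏ p ∈ primesUpTo y, (1 - Real.exp (-(Real.log p / Real.log y)) / p)⁻¹
      = ∏ p ∈ (⌊y⌋₊ + 1).primesBelow, (1 - g p)⁻¹ :=
        Finset.prod_congr rfl fun p hp => by rw [hgp p (mem_primesUpTo.1 hp).1]
    _ = ∑' n : (⌊y⌋₊ + 1).smoothNumbers, g n := hE.tsum_eq.symm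
    _ ≤ ∑' n : ℕ, g n := hS.tsum_subtype_le _ _ h0
    _ = ∑' n : ℕ, 1 / (n : ℝ) ^ σ := tsum_congr fun n => by
        rw [hg, Real.rpow_neg (Nat.cast_nonneg n), one_div]
    _ ≤ 2 * Real.log y := h2

/-- The logarithm of the largest `z`-friable divisor of `n`. -/
def smallPart (z : ℝ) (n : ℕ) : ℝ := ∑ p ∈ primesUpTo z, blk n p

theorem smallPart_mul {m n : ℕ} (hm : m ≠ 0) (hn : n ≠ 0) (z : ℝ) :
    smallPart z (m * n) = smallPart z m + smallPart z n := by
  simp only [smallPart, blk_mul hm hn, Finset.sum_add_distrib]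

theorem smallPart_le_log {n : ℕ} (hn : n ≠ 0) (z : ℝ) : smallPart z n ≤ Real.log n := by
  rw [← sum_blk_of_subset hn (Finset.subset_union_right (s₁ := primesUpTo z))]
  exact Finset.sum_le_sum_of_subset_of_nonneg Finset.subset_union_left
    fun p _ _ => blk_nonneg n p

theorem smallPart_prime {p : ℕ} (hp : p.Prime) (z : ℝ) :
    smallPart z p = if (p : ℝ) ≤ z then Real.log p else 0 := by
  have h : ∀ q ∈ primesUpTo z, blk p q = if q = p then Real.log p else 0 := fun q _ => by
    rw [blk, hp.factorization, Finsupp.single_apply]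
    by_cases h : p = q
    · simp [h]
    · simp [h, Ne.symm h]
  rw [smallPart, Finset.sum_congr rfl h, Finset.sum_ite_eq']
  simp [mem_primesUpTo, hp]

/-- The completely multiplicative weight `exp (η * smallPart z n) / n`. -/
def tilt (η z : ℝ) : ℕ →* ℝ where
  toFun n := if n = 0 then 0 else Real.exp (η * smallPart z n) / n
  map_one' := by simp [smallPart, blk]
  map_mul' m n := by
    by_cases hm : m = 0
    · simp [hm]
    by_cases hn : n = 0
    · simp [hn]
    rw [if_neg (mul_ne_zero hm hn), if_neg hm, if_neg hn, smallPart_mul hm hn, mul_add,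
      Real.exp_add, Nat.cast_mul]
    field_simp

theorem tilt_apply {n : ℕ} (hn : n ≠ 0) (η z : ℝ) :
    tilt η z n = Real.exp (η * smallPart z n) / n := if_neg hn

theorem tilt_nonneg (η z : ℝ) (n : ℕ) : 0 ≤ tilt η z n := by
  by_cases hn : n = 0
  · simp [hn, tilt]
  · rw [tilt_apply hn]
    positivity

theorem tilt_prime_le {η z : ℝ} (hη0 : 0 ≤ η) (hη : η ≤ 1 / 2) {p : ℕ} (hp : p.Prime) :
    tilt η z p ≤ 3 / 4 := by
  have hp2 : (2 : ℝ) ≤ p := by exact_mod_cast hp.two_le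
  have hp0 : (0 : ℝ) < p := by linarith
  have hv : smallPart z p ≤ Real.log p := smallPart_le_log hp.ne_zero z
  have h1 : Real.exp (η * smallPart z p) ^ 2 ≤ p := by
    rw [← Real.exp_nat_mul, ← Real.le_log_iff_exp_le hp0]
    have := Real.log_natCast_nonneg p
    push_cast
    nlinarith
  rw [tilt_apply hp.ne_zero, div_le_iff₀ hp0]
  refine abs_le_of_sq_le_sq' ?_ (by positivity) |>.2
  nlinarith

theorem inv_one_sub_le {a b : ℝ} (hab : a ≤ b) (hb : b ≤ 3 / 4) :
    (1 - b)⁻¹ ≤ (1 - a)⁻¹ * Real.exp (4 * (b - a)) := by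
  rw [inv_mul_eq_div, le_div_iff₀ (by linarith), inv_mul_le_iff₀ (by linarith)]
  have := Real.add_one_le_exp (4 * (b - a))
  nlinarith

theorem tilt_prime_sub_le {η z y : ℝ} (hη0 : 0 ≤ η) {p : ℕ}
    (hp : p.Prime) :
    tilt η z p - Real.exp (-(Real.log p / Real.log y)) / p ≤
      η * Real.exp (η * Real.log z) * (if (p : ℝ) ≤ z then Real.log p / p else 0) +
        1 / Real.log y * (Real.log p / p) := by
  have hp0 : (0 : ℝ) < p := by exact_mod_cast hp.pos
  have h1 := Real.add_one_le_exp (-(Real.log p / Real.log y))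
  have h2 : Real.exp (η * smallPart z p) - 1 ≤
      η * Real.exp (η * Real.log z) * (if (p : ℝ) ≤ z then Real.log p else 0) := by
    rw [smallPart_prime hp]
    split_ifs with h
    · have h3 := Real.add_one_le_exp (-(η * Real.log p))
      have h4 : Real.exp (η * Real.log p) ≤ Real.exp (η * Real.log z) :=
        Real.exp_le_exp.2 (mul_le_mul_of_nonneg_left (Real.log_le_log hp0 h) hη0)
      have h5 : Real.exp (η * Real.log p) * Real.exp (-(η * Real.log p)) = 1 := by
        rw [← Real.exp_add]
        simp
      have h6 : 0 ≤ η * Real.log p := mul_nonneg hη0 (Real.log_natCast_nonneg p)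
      nlinarith [Real.exp_pos (η * Real.log p)]
    · simp
  have h3 : (if (p : ℝ) ≤ z then Real.log p / p else 0) =
      (if (p : ℝ) ≤ z then Real.log p else 0) / p := by
    split_ifs <;> simp
  rw [tilt_apply hp.ne_zero, h3, ← sub_div, ← mul_div_assoc, ← mul_div_assoc, ← add_div]
  refine div_le_div_of_nonneg_right ?_ hp0.le
  rw [one_div, inv_mul_eq_div]
  linarith

theorem sum_tilt_le {L₂ : ℝ}
    (hL₂ : ∀ y : ℝ, 2 ≤ y → L₂ ≤ Real.log y →
      ∏ p ∈ primesUpTo y, (1 - Real.exp (-(Real.log p / Real.log y)) / p)⁻¹ ≤ 2 * Real.log y)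
    {x y z η : ℝ} (hy : 2 ≤ y) (hL : L₂ ≤ Real.log y) (hz : 1 ≤ z) (hη0 : 0 ≤ η)
    (hη : η ≤ 1 / 2) :
    ∑ n ∈ Sf x y, tilt η z n ≤
      2 * Real.log y * Real.exp (8 * (η * Real.log z * Real.exp (η * Real.log z)) + 8) := by
  have hy0 : 0 < Real.log y := Real.log_pos (by linarith)
  refine (sum_Sf_le_prod (tilt_nonneg η z)
    (fun p hp => (tilt_prime_le hη0 hη hp).trans_lt (by norm_num)) x y).trans ?_
  set a : ℕ → ℝ := fun p => Real.exp (-(Real.log p / Real.log y)) / p with ha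
  have hab : ∀ p : ℕ, p.Prime → a p ≤ tilt η z p := fun p hp => by
    rw [tilt_apply hp.ne_zero]
    refine div_le_div_of_nonneg_right (Real.exp_le_exp.2 ?_) (Nat.cast_nonneg p)
    have h1 : 0 ≤ smallPart z p := Finset.sum_nonneg fun q _ => blk_nonneg p q
    have h2 := Real.log_natCast_nonneg p
    have h3 : 0 ≤ Real.log p / Real.log y := by positivity
    have h4 : 0 ≤ η * smallPart z p := by positivity
    linarith
  have hsum : ∑ p ∈ primesUpTo y, (tilt η z p - a p) ≤
      2 * (η * Real.log z * Real.exp (η * Real.log z)) + 2 := by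
    refine (Finset.sum_le_sum fun p hp =>
      tilt_prime_sub_le (z := z) hη0 (mem_primesUpTo.1 hp).1).trans ?_
    rw [Finset.sum_add_distrib, ← Finset.mul_sum, ← Finset.mul_sum, ← Finset.sum_filter]
    have h1 : ∑ p ∈ (primesUpTo y).filter (fun p : ℕ => (p : ℝ) ≤ z), Real.log p / p ≤
        2 * Real.log z := by
      refine le_trans (Finset.sum_le_sum_of_subset_of_nonneg (fun p hp => ?_)
        fun p _ _ => div_nonneg (Real.log_natCast_nonneg p) (Nat.cast_nonneg p))
        (sum_log_div_le hz)
      rw [Finset.mem_filter] at hp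
      exact mem_primesUpTo.2 ⟨(mem_primesUpTo.1 hp.1).1, hp.2⟩
    have h2 : 1 / Real.log y * ∑ p ∈ primesUpTo y, Real.log p / (p : ℝ) ≤ 2 := by
      rw [one_div, inv_mul_le_iff₀ hy0, mul_comm]
      exact sum_log_div_le (by linarith)
    have h3 := mul_le_mul_of_nonneg_left h1 (show 0 ≤ η * Real.exp (η * Real.log z) by positivity)
    linarith
  calc ∏ p ∈ primesUpTo y, (1 - tilt η z p)⁻¹
      ≤ ∏ p ∈ primesUpTo y, ((1 - a p)⁻¹ * Real.exp (4 * (tilt η z p - a p))) :=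
        Finset.prod_le_prod
          (fun p hp => by
            have := tilt_prime_le (z := z) hη0 hη (mem_primesUpTo.1 hp).1
            exact inv_nonneg.2 (by linarith))
          fun p hp => inv_one_sub_le (hab p (mem_primesUpTo.1 hp).1)
            (tilt_prime_le hη0 hη (mem_primesUpTo.1 hp).1)
    _ = (∏ p ∈ primesUpTo y, (1 - a p)⁻¹) *
          Real.exp (4 * ∑ p ∈ primesUpTo y, (tilt η z p - a p)) := by
        rw [Finset.prod_mul_distrib, ← Real.exp_sum, Finset.mul_sum]
    _ ≤ 2 * Real.log y * Real.exp (8 * (η * Real.log z * Real.exp (η * Real.log z)) + 8) := by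
        refine mul_le_mul (hL₂ y hy hL) (Real.exp_le_exp.2 ?_) (Real.exp_pos _).le (by positivity)
        linarith

theorem card_large_smallPart_mul_le {T y z η : ℝ} (hη : 0 ≤ η) :
    T / 4 * (((Sf (Real.exp T) y).filter fun n =>
        T / 4 ≤ smallPart z n ∧ bigPrimes n (T / 8) = ∅).card : ℝ) ≤
      6 * Real.exp (T - η * (T / 8)) * ∑ n ∈ Sf (Real.exp T) y, tilt η z n := by
  set S := Sf (Real.exp T) y with hS
  set Bad := S.filter fun n => T / 4 ≤ smallPart z n ∧ bigPrimes n (T / 8) = ∅ with hBad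
  set M := S.filter fun m => T / 8 ≤ smallPart z m with hM
  set Λ := ArithmeticFunction.vonMangoldt with hΛ
  have hne : ∀ n ∈ S, n ≠ 0 := fun n hn => (mem_Sf.1 hn).1
  have h1 : T / 4 * (Bad.card : ℝ) ≤ ∑ n ∈ Bad, ∑ d ∈ n.divisors, Λ d := by
    rw [mul_comm, ← nsmul_eq_mul]
    refine Finset.card_nsmul_le_sum _ _ _ fun n hn => ?_
    rw [Finset.mem_filter] at hn
    rw [hΛ, ArithmeticFunction.vonMangoldt_sum]
    exact hn.2.1.trans (smallPart_le_log (hne n hn.1) z)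
  have h2 : ∑ n ∈ Bad, ∑ d ∈ n.divisors, Λ d ≤
      ∑ m ∈ M, ∑ d ∈ Finset.Ioc 0 ⌊Real.exp T / m⌋₊, Λ d := by
    have h3 : ∀ n ∈ Bad, ∑ d ∈ n.divisors, Λ d = ∑ d ∈ n.divisors.filter (Λ · ≠ 0), Λ d :=
      fun n _ => (Finset.sum_filter_ne_zero _).symm
    rw [Finset.sum_congr rfl h3, Finset.sum_sigma', Finset.sum_sigma']
    have hinj : Set.InjOn (fun q : (_ : ℕ) × ℕ => (⟨q.1 / q.2, q.2⟩ : (_ : ℕ) × ℕ))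
        (Bad.sigma fun n => n.divisors.filter (Λ · ≠ 0) : Finset ((_ : ℕ) × ℕ)) := by
      rintro ⟨n, d⟩ hq ⟨n', d'⟩ hq' he
      simp only [Finset.coe_sigma, Set.mem_sigma_iff, Finset.mem_coe, Finset.mem_filter,
        Nat.mem_divisors] at hq hq'
      simp only [Sigma.mk.injEq, heq_eq_eq] at he
      obtain ⟨he, rfl⟩ := he
      have := Nat.div_mul_cancel hq.2.1.1
      rw [he, Nat.div_mul_cancel hq'.2.1.1] at this
      simp [this]
    rw [← Finset.sum_image (f := fun q : (_ : ℕ) × ℕ => Λ q.2) hinj]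
    refine Finset.sum_le_sum_of_subset_of_nonneg (fun q hq => ?_)
      fun _ _ _ => ArithmeticFunction.vonMangoldt_nonneg
    obtain ⟨⟨n, d⟩, hnd, rfl⟩ := Finset.mem_image.1 hq
    simp only [Finset.mem_sigma, Finset.mem_filter, Nat.mem_divisors] at hnd
    obtain ⟨hn, ⟨hdn, hn0⟩, hd⟩ := hnd
    rw [hBad, Finset.mem_filter] at hn
    obtain ⟨hnS, hnT, hbig⟩ := hn
    obtain ⟨m, rfl⟩ := hdn
    have hd0 : d ≠ 0 := left_ne_zero_of_mul hn0
    have hm0 : m ≠ 0 := right_ne_zero_of_mul hn0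
    have hle := (mem_Sf.1 hnS).2.1
    have hmpos : (0 : ℝ) < m := by exact_mod_cast Nat.pos_of_ne_zero hm0
    have hd1 : (1 : ℝ) ≤ d := by exact_mod_cast Nat.one_le_iff_ne_zero.2 hd0
    simp only [Finset.mem_sigma, Nat.mul_div_cancel_left m (Nat.pos_of_ne_zero hd0)]
    push_cast at hle
    refine ⟨Finset.mem_filter.2 ⟨mem_Sf.2 ⟨hm0, by nlinarith, fun p hp hpm =>
      (mem_Sf.1 hnS).2.2 p hp (hpm.mul_left d)⟩, ?_⟩,
      Finset.mem_Ioc.2 ⟨Nat.pos_of_ne_zero hd0, Nat.le_floor ?_⟩⟩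
    · rw [smallPart_mul hd0 hm0] at hnT
      have h4 : Real.log d < T / 8 := by
        obtain ⟨p, k, hp, hk, rfl⟩ := (isPrimePow_nat_iff _).1
          (ArithmeticFunction.vonMangoldt_ne_zero_iff.1 hd)
        have hpn : p ∣ p ^ k * m := (dvd_pow_self p hk.ne').mul_right m
        have h5 : p ∉ bigPrimes (p ^ k * m) (T / 8) := by simp [hbig]
        rw [bigPrimes, Finset.mem_filter, not_and, not_le] at h5
        refine lt_of_le_of_lt ?_ (h5 (Nat.mem_primeFactors.2 ⟨hp, hpn, hn0⟩))
        rw [Nat.cast_pow, Real.log_pow, blk]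
        refine mul_le_mul_of_nonneg_right ?_ (Real.log_natCast_nonneg p)
        exact_mod_cast (hp.pow_dvd_iff_le_factorization hn0).1 (dvd_mul_right _ _)
      linarith [smallPart_le_log hd0 z]
    · rw [le_div_iff₀ hmpos]
      exact hle
  have h3 : Real.log 4 + 4 ≤ 6 := by
    have : Real.log 4 = 2 * Real.log 2 := by
      rw [show (4 : ℝ) = 2 ^ 2 by norm_num, Real.log_pow]
      norm_num
    linarith [Real.log_two_lt_d9]
  refine h1.trans (h2.trans ?_)
  calc ∑ m ∈ M, ∑ d ∈ Finset.Ioc 0 ⌊Real.exp T / m⌋₊, Λ d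
      ≤ ∑ m ∈ M, 6 * Real.exp (T - η * (T / 8)) * tilt η z m := by
        refine Finset.sum_le_sum fun m hm => ?_
        rw [hM, Finset.mem_filter] at hm
        have h5 : (0 : ℝ) ≤ Real.exp T / m := by positivity
        refine (Chebyshev.psi_le_const_mul_self h5).trans ((mul_le_mul_of_nonneg_right h3 h5).trans ?_)
        rw [tilt_apply (hne m hm.1), mul_assoc, ← mul_div_assoc (Real.exp _), ← Real.exp_add]
        refine mul_le_mul_of_nonneg_left (div_le_div_of_nonneg_right (Real.exp_le_exp.2 ?_)
          (Nat.cast_nonneg m)) (by norm_num)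
        nlinarith [hm.2]
    _ ≤ ∑ m ∈ S, 6 * Real.exp (T - η * (T / 8)) * tilt η z m :=
        Finset.sum_le_sum_of_subset_of_nonneg (Finset.filter_subset _ _) fun m _ _ =>
          mul_nonneg (by positivity) (tilt_nonneg η z m)
    _ = _ := by rw [Finset.mul_sum]

theorem exists_card_large_smallPart_le :
    ∃ u₀ ≥ (1 : ℝ), ∃ C > (0 : ℝ), ∀ y u : ℝ, 2 ≤ y → u₀ ≤ u →
      Real.log u ≤ Real.log y / 256 → u ≤ (primesUpTo y).card →
      (((Sf (Real.exp (u * Real.log y)) y).filter fun n =>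
        u * Real.log y / 4 ≤ smallPart (Real.exp (Real.log y / 256)) n).card : ℝ) ≤
        C * Real.exp (-(u / 64)) * Psi (Real.exp (u * Real.log y)) y := by
  obtain ⟨L₁, -, hL₁⟩ := exists_le_Psi
  obtain ⟨L₂, -, hL₂⟩ := exists_prod_zeta_factor_le
  refine ⟨max 16 (Real.exp (max L₁ L₂ / 256)), le_max_of_le_left (by norm_num),
    64 * Real.exp (3 / 2) + 96, by positivity, fun y u hy hu huy huk => ?_⟩
  have hu16 : 16 ≤ u := (le_max_left _ _).trans hu
  have hu0 : 0 < u := by linarith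
  set L := Real.log y with hLdef
  have hL0 : 0 < L := Real.log_pos (by linarith)
  have hLL : max L₁ L₂ ≤ L := by
    have := (Real.le_log_iff_exp_le hu0).2 ((le_max_right _ _).trans hu)
    linarith
  have hPsi := hL₁ y hy ((le_max_left _ _).trans hLL) u (by linarith)
  rw [← hLdef] at hPsi
  set T := u * L with hT
  set z := Real.exp (L / 256) with hz
  set P := Psi (Real.exp T) y with hP
  have hP0 : 0 ≤ P := Psi_nonneg _ _
  have hTL : T / L = u := by rw [hT]; field_simp
  have hlogu : 2.77 ≤ Real.log u := by
    have h1 : Real.log 16 = 4 * Real.log 2 := by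
      rw [show (16 : ℝ) = 2 ^ 4 by norm_num, Real.log_pow]
      norm_num
    have h2 := Real.log_le_log (by norm_num) hu16
    linarith [Real.log_two_gt_d9]
  have hbig : (((Sf (Real.exp T) y).filter fun n => 1 ≤ (bigPrimes n (u / 8 * L)).card).card : ℝ) ≤
      64 * Real.exp (3 / 2) * Real.exp (-(u / 64)) * P := by
    have h1 := card_many_bigPrimes_le hy le_rfl
      (T := T) (mul_le_mul_of_nonneg_right huk hL0.le) (by positivity) 1
      (A := u / 8) (by linarith)
    rw [← hLdef, hTL, pow_one, Nat.factorial_one, Nat.cast_one, div_one] at h1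
    refine h1.trans (mul_le_mul_of_nonneg_right ?_ hP0)
    have h2 : 1 - (u / 8 - 2) * 1 / 4 = 3 / 2 + (-(u / 64) + -(u / 64)) := by ring
    have h3 : u * Real.exp (-(u / 64)) ≤ 64 := by
      rw [Real.exp_neg, ← div_eq_mul_inv, div_le_iff₀ (Real.exp_pos _)]
      linarith [Real.add_one_le_exp (u / 64)]
    rw [h2, Real.exp_add, Real.exp_add]
    have h4 : 0 ≤ Real.exp (3 / 2) * Real.exp (-(u / 64)) := by positivity
    nlinarith
  have hsmall : (((Sf (Real.exp T) y).filter fun n =>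
      T / 4 ≤ smallPart z n ∧ bigPrimes n (T / 8) = ∅).card : ℝ) ≤
      96 * Real.exp (-(u / 64)) * P := by
    set N := (((Sf (Real.exp T) y).filter fun n =>
      T / 4 ≤ smallPart z n ∧ bigPrimes n (T / 8) = ∅).card : ℝ) with hN
    set η := 128 * Real.log u / L with hη
    have hη0 : 0 ≤ η := by positivity
    have hη1 : η ≤ 1 / 2 := by
      rw [hη, div_le_iff₀ hL0]
      linarith
    have h1 := card_large_smallPart_mul_le (T := T) (y := y) (z := z) hη0
    rw [← hN] at h1
    have h2 := sum_tilt_le hL₂ (x := Real.exp T) hy ((le_max_right _ _).trans hLL)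
      (Real.one_le_exp (by positivity : 0 ≤ L / 256)) hη0 hη1
    have h3 : η * Real.log z = Real.log u / 2 := by
      rw [hz, Real.log_exp, hη]
      field_simp
      norm_num
    have h4 : Real.exp (Real.log u / 2) = √u := by
      rw [Real.exp_half, Real.exp_log hu0]
    have h5 : η * (T / 8) = 16 * (u * Real.log u) := by
      rw [hη, hT]
      field_simp
      norm_num
    rw [← hz, ← hLdef, h3, h4] at h2
    rw [h5] at h1
    have h6 : N ≤ 48 * Real.exp (T - 16 * (u * Real.log u)) *
        Real.exp (8 * (Real.log u / 2 * √u) + 8) := by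
      have h7 := h1.trans (mul_le_mul_of_nonneg_left h2 (by positivity))
      have h8 : L * (N / 4) ≤ L * (u * N / 4) := by
        have : 0 ≤ N := Nat.cast_nonneg _
        refine mul_le_mul_of_nonneg_left ?_ hL0.le
        nlinarith
      have h9 : L * (N / 4) ≤ L * (12 * Real.exp (T - 16 * (u * Real.log u)) *
        Real.exp (8 * (Real.log u / 2 * √u) + 8)) := by
        refine h8.trans (le_of_eq_of_le ?_ (h7.trans_eq ?_))
        · rw [hT]; ring
        · ring
      have := le_of_mul_le_mul_left h9 hL0
      linarith
    have h7 : Real.exp T ≤ 2 * P * Real.exp (8 * u * Real.log (2 * u)) := by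
      have h8 : Real.exp T / 2 ≤ P * Real.exp (8 * u * Real.log (2 * u)) := by
        rwa [← div_le_iff₀ (Real.exp_pos _), div_eq_mul_inv, ← Real.exp_neg]
      linarith
    have h8 : √u ≤ u / 4 := by
      rw [Real.sqrt_le_left (by positivity)]
      nlinarith
    have h9 : 8 * u * Real.log (2 * u) + (-(16 * (u * Real.log u)) +
        (8 * (Real.log u / 2 * √u) + 8)) ≤ -(u / 64) := by
      rw [Real.log_mul (by norm_num) hu0.ne']
      have h10 : Real.log u * √u ≤ Real.log u * (u / 4) :=
        mul_le_mul_of_nonneg_left h8 (by linarith)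
      nlinarith [mul_le_mul_of_nonneg_left hlogu hu0.le,
        mul_le_mul_of_nonneg_left Real.log_two_lt_d9.le hu0.le]
    calc N ≤ 48 * Real.exp (T - 16 * (u * Real.log u)) *
          Real.exp (8 * (Real.log u / 2 * √u) + 8) := h6
      _ = 48 * Real.exp T * Real.exp (-(16 * (u * Real.log u)) +
          (8 * (Real.log u / 2 * √u) + 8)) := by
        rw [sub_eq_add_neg, mul_assoc, ← Real.exp_add, add_assoc, Real.exp_add T, mul_assoc]
      _ ≤ 48 * (2 * P * Real.exp (8 * u * Real.log (2 * u))) *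
          Real.exp (-(16 * (u * Real.log u)) + (8 * (Real.log u / 2 * √u) + 8)) := by gcongr
      _ = 96 * Real.exp (8 * u * Real.log (2 * u) + (-(16 * (u * Real.log u)) +
          (8 * (Real.log u / 2 * √u) + 8))) * P := by
        rw [Real.exp_add (8 * u * Real.log (2 * u))]
        ring
      _ ≤ 96 * Real.exp (-(u / 64)) * P := by gcongr
  have hsub : ((Sf (Real.exp T) y).filter fun n => T / 4 ≤ smallPart z n) ⊆
      ((Sf (Real.exp T) y).filter fun n => 1 ≤ (bigPrimes n (u / 8 * L)).card) ∪
      ((Sf (Real.exp T) y).filter fun n => T / 4 ≤ smallPart z n ∧ bigPrimes n (T / 8) = ∅) := by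
    intro n hn
    rw [Finset.mem_filter] at hn
    rw [Finset.mem_union, Finset.mem_filter, Finset.mem_filter]
    rcases Finset.eq_empty_or_nonempty (bigPrimes n (T / 8)) with h | h
    · exact Or.inr ⟨hn.1, hn.2, h⟩
    · refine Or.inl ⟨hn.1, ?_⟩
      rw [show u / 8 * L = T / 8 by rw [hT]; ring]
      exact h.card_pos
  have h1 : (((Sf (Real.exp T) y).filter fun n => T / 4 ≤ smallPart z n).card : ℝ) ≤ _ :=
    Nat.cast_le.2 ((Finset.card_le_card hsub).trans (Finset.card_union_le _ _))
  rw [Nat.cast_add] at h1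
  calc _ ≤ _ := h1
    _ ≤ _ := add_le_add hbig hsmall
    _ = _ := by ring

theorem le_sum_blk_sq {n : ℕ} (hn : n ≠ 0) {T h ε : ℝ} (hh : 0 < h) (hlog : T / 2 ≤ Real.log n)
    (hε : 0 ≤ ε)
    (hsmall : ∑ p ∈ n.primeFactors.filter (fun p => blk n p ≤ ε * h), blk n p ≤ T / 4) :
    ε / 4 * (T / h) ≤ ∑ p ∈ n.primeFactors, (blk n p / h) ^ 2 := by
  have h1 := Finset.sum_filter_add_sum_filter_not n.primeFactors (fun p => blk n p ≤ ε * h) (blk n)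
  rw [sum_blk hn] at h1
  have h2 : T / 4 ≤ ∑ p ∈ n.primeFactors.filter (fun p => ¬ blk n p ≤ ε * h), blk n p := by
    linarith
  calc ε / 4 * (T / h) = ε / h * (T / 4) := by ring
    _ ≤ ε / h * ∑ p ∈ n.primeFactors.filter (fun p => ¬ blk n p ≤ ε * h), blk n p :=
        mul_le_mul_of_nonneg_left h2 (by positivity)
    _ ≤ ∑ p ∈ n.primeFactors.filter (fun p => ¬ blk n p ≤ ε * h), (blk n p / h) ^ 2 := by
        rw [Finset.mul_sum]
        refine Finset.sum_le_sum fun p hp => ?_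
        have h3 := (not_le.1 (Finset.mem_filter.1 hp).2).le
        rw [div_pow, sq, sq, mul_div_mul_comm, div_mul_eq_mul_div, mul_div_assoc]
        refine mul_le_mul_of_nonneg_right ?_ (div_nonneg (blk_nonneg n p) hh.le)
        rwa [le_div_iff₀ hh]
    _ ≤ _ := Finset.sum_le_sum_of_subset_of_nonneg (Finset.filter_subset _ _)
        fun p _ _ => sq_nonneg _

theorem card_log_lt_le {T h y : ℝ} (hy : 2 ≤ y) (hL : Real.log y ≤ h)
    (hT : T ≤ (primesUpTo y).card * h) (hT0 : 0 ≤ T) :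
    (((Sf (Real.exp T) y).filter fun n : ℕ => Real.log n < T / 2).card : ℝ) ≤
      Real.exp (1 - T / h / 8) * Psi (Real.exp T) y := by
  have h1 := Psi_decay hy hL hT (s := T / 2) (by positivity)
  rw [show T / 2 / (4 * h) = T / h / 8 by ring] at h1
  refine le_trans (Nat.cast_le.2 (Finset.card_le_card fun n hn => ?_)) h1
  rw [Finset.mem_filter] at hn
  obtain ⟨hn0, -, hp⟩ := mem_Sf.1 hn.1
  refine mem_Sf.2 ⟨hn0, ?_, hp⟩
  rw [← Real.log_le_iff_le_exp (by exact_mod_cast Nat.pos_of_ne_zero hn0)]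
  linarith [hn.2]

theorem card_primesUpTo_le {z : ℝ} (hz : 0 ≤ z) : ((primesUpTo z).card : ℝ) ≤ z := by
  refine le_trans (Nat.cast_le.2 ?_) (Nat.floor_le hz)
  calc (primesUpTo z).card ≤ (Finset.Icc 1 ⌊z⌋₊).card := Finset.card_le_card fun p hp => by
        obtain ⟨hp, hpz⟩ := mem_primesUpTo.1 hp
        exact Finset.mem_Icc.2 ⟨hp.one_le, Nat.le_floor hpz⟩
    _ = ⌊z⌋₊ := by simp

theorem sum_le_of_card_le {s : Finset ℕ} {f : ℕ → ℝ} {a b : ℝ} (hf : ∀ p ∈ s, f p ≤ a)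
    (ha : 0 ≤ a) (hs : (s.card : ℝ) ≤ b) : ∑ p ∈ s, f p ≤ b * a := by
  refine (Finset.sum_le_card_nsmul _ _ _ hf).trans ?_
  rw [nsmul_eq_mul]
  exact mul_le_mul_of_nonneg_right hs ha

theorem exists_card_second_moment_lt_le :
    ∃ U₀ ≥ (1 : ℝ), ∃ C > (0 : ℝ), ∀ y T U : ℝ, 2 ≤ y →
      U = min (T / Real.log y) (primesUpTo y).card → U₀ ≤ U →
      (((Sf (Real.exp T) y).filter fun n =>
        ∑ p ∈ n.primeFactors, (blk n p / (T / U)) ^ 2 < U / 1024).card : ℝ) ≤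
        C * Real.exp (-(U / 64)) * Psi (Real.exp T) y := by
  obtain ⟨u₀, hu₀, C, hC, hsp⟩ := exists_card_large_smallPart_le
  refine ⟨u₀, hu₀, Real.exp 1 + C, by positivity, fun y T U hy hU hUu => ?_⟩
  have hU0 : 0 < U := by linarith
  have hL0 : 0 < Real.log y := Real.log_pos (by linarith)
  have hU1 : U ≤ T / Real.log y := hU ▸ min_le_left _ _
  have hU2 : U ≤ (primesUpTo y).card := hU ▸ min_le_right _ _
  have hT0 : 0 < T := by
    rw [le_div_iff₀ hL0] at hU1
    nlinarith
  set h := T / U with hh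
  have hh0 : 0 < h := by positivity
  have hTh : T / h = U := by rw [hh]; field_simp
  have hLh : Real.log y ≤ h := by
    rw [le_div_iff₀ hL0] at hU1
    rw [hh, le_div_iff₀ hU0]
    linarith
  have hTk : T ≤ (primesUpTo y).card * h := by
    rw [← div_le_iff₀ hh0, hTh]
    exact hU2
  have hP0 := Psi_nonneg (Real.exp T) y
  have hlog := card_log_lt_le hy hLh hTk hT0.le
  rw [hTh] at hlog
  have hlog' : (((Sf (Real.exp T) y).filter fun n : ℕ => Real.log n < T / 2).card : ℝ) ≤
      Real.exp 1 * Real.exp (-(U / 64)) * Psi (Real.exp T) y := by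
    refine hlog.trans (mul_le_mul_of_nonneg_right ?_ hP0)
    rw [← Real.exp_add, Real.exp_le_exp]
    linarith
  have hdet : ∀ n ∈ Sf (Real.exp T) y, T / 2 ≤ Real.log n →
      ∑ p ∈ n.primeFactors.filter (fun p => blk n p ≤ 1 / 256 * h), blk n p ≤ T / 4 →
      U / 1024 ≤ ∑ p ∈ n.primeFactors, (blk n p / h) ^ 2 := fun n hn h1 h2 => by
    have h3 := le_sum_blk_sq (mem_Sf.1 hn).1 hh0 h1 (by norm_num) h2
    rw [hTh] at h3
    linarith
  have hreduce : ((Sf (Real.exp T) y).filter fun n =>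
        ∑ p ∈ n.primeFactors, (blk n p / h) ^ 2 < U / 1024) ⊆
      ((Sf (Real.exp T) y).filter fun n : ℕ => Real.log n < T / 2) ∪
      ((Sf (Real.exp T) y).filter fun n =>
        T / 4 < ∑ p ∈ n.primeFactors.filter (fun p => blk n p ≤ 1 / 256 * h), blk n p) := by
    intro n hn
    rw [Finset.mem_filter] at hn
    rw [Finset.mem_union, Finset.mem_filter, Finset.mem_filter]
    by_contra! hcon
    exact (hdet n hn.1 (hcon.1 hn.1) (hcon.2 hn.1)).not_gt hn.2
  have hcard : (((Sf (Real.exp T) y).filter fun n =>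
        T / 4 < ∑ p ∈ n.primeFactors.filter (fun p => blk n p ≤ 1 / 256 * h), blk n p).card : ℝ) ≤
      C * Real.exp (-(U / 64)) * Psi (Real.exp T) y := by
    have hempty : (∀ n ∈ Sf (Real.exp T) y,
        ((n.primeFactors.filter (fun p => blk n p ≤ 1 / 256 * h)).card : ℝ) ≤ U) →
        (((Sf (Real.exp T) y).filter fun n =>
          T / 4 < ∑ p ∈ n.primeFactors.filter (fun p => blk n p ≤ 1 / 256 * h), blk n p).card : ℝ) ≤
        C * Real.exp (-(U / 64)) * Psi (Real.exp T) y := fun hc => by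
      rw [Finset.filter_eq_empty_iff.2, Finset.card_empty, Nat.cast_zero]
      · positivity
      · intro n hn
        refine not_lt.2 ((sum_le_of_card_le (fun p hp => (Finset.mem_filter.1 hp).2)
          (by positivity) (hc n hn)).trans ?_)
        have : U * h = T := by rw [hh]; field_simp
        linarith
    rcases le_total ((primesUpTo y).card : ℝ) (T / Real.log y) with hk | hk
    · refine hempty fun n hn => ?_
      rw [hU, min_eq_right hk]
      exact_mod_cast Finset.card_le_card
        ((Finset.filter_subset _ _).trans (primeFactors_subset_primesUpTo hn))
    · rw [min_eq_left hk] at hU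
      have hhL : h = Real.log y := by
        rw [hh, hU]
        field_simp
      have hTU : T = U * Real.log y := by
        rw [hU]
        field_simp
      have hsub : ∀ n : ℕ, n.primeFactors.filter (fun p => blk n p ≤ 1 / 256 * h) ⊆
          primesUpTo (Real.exp (Real.log y / 256)) := fun n p hp => by
        rw [Finset.mem_filter, Nat.mem_primeFactors] at hp
        obtain ⟨⟨hp, hpn, hn0⟩, hb⟩ := hp
        refine mem_primesUpTo.2 ⟨hp, ?_⟩
        rw [← Real.log_le_iff_le_exp (by exact_mod_cast hp.pos)]
        have h1 : (1 : ℝ) ≤ n.factorization p := by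
          exact_mod_cast hp.factorization_pos_of_dvd hn0 hpn
        rw [blk, hhL] at hb
        nlinarith [Real.log_natCast_nonneg p]
      rcases le_total (Real.exp (Real.log y / 256)) U with hz | hz
      · refine hempty fun n hn => ?_
        exact (Nat.cast_le.2 (Finset.card_le_card (hsub n))).trans
          ((card_primesUpTo_le (Real.exp_pos _).le).trans hz)
      · have h1 := hsp y U hy hUu ((Real.log_le_iff_le_exp hU0).2 hz) hU2
        rw [← hTU] at h1
        refine le_trans (Nat.cast_le.2 (Finset.card_le_card fun n hn => ?_)) h1
        rw [Finset.mem_filter] at hn ⊢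
        exact ⟨hn.1, hn.2.le.trans (Finset.sum_le_sum_of_subset_of_nonneg (hsub n)
          fun p _ _ => blk_nonneg n p)⟩
  have h1 : (((Sf (Real.exp T) y).filter fun n =>
      ∑ p ∈ n.primeFactors, (blk n p / h) ^ 2 < U / 1024).card : ℝ) ≤ _ :=
    Nat.cast_le.2 ((Finset.card_le_card hreduce).trans (Finset.card_union_le _ _))
  rw [Nat.cast_add] at h1
  calc _ ≤ _ := h1
    _ ≤ _ := add_le_add hlog' hcard
    _ = _ := by ring

theorem le_wn_of_moments {n : ℕ} (hn0 : n ≠ 0) (hn1 : n ≠ 1) {h K : ℝ} (hh : 0 < h) (hK : 0 ≤ K)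
    (hm : 81 * K * ∑ p ∈ n.primeFactors, (blk n p / h) ^ 4 ≤
      5 * (∑ p ∈ n.primeFactors, (blk n p / h) ^ 2) ^ 2) : K ≤ wn n := by
  have hν : ∀ p ∈ n.primeFactors, (1 : ℝ) ≤ n.factorization p := fun p hp => by
    obtain ⟨hp, hpn, -⟩ := Nat.mem_primeFactors.1 hp
    exact_mod_cast hp.factorization_pos_of_dvd hn0 hpn
  set S2 := ∑ p ∈ n.primeFactors, (blk n p / h) ^ 2 with hS2
  set S4 := ∑ p ∈ n.primeFactors, (blk n p / h) ^ 4 with hS4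
  have hS2' : 0 ≤ S2 := Finset.sum_nonneg fun p _ => sq_nonneg _
  have h2 : h ^ 2 * S2 / 12 ≤ m2 n := by
    rw [m2, hS2, Finset.mul_sum, one_div_mul_eq_div]
    refine div_le_div_of_nonneg_right (Finset.sum_le_sum fun p hp => ?_) (by norm_num)
    rw [← mul_pow, mul_div_cancel₀ _ hh.ne', blk, mul_pow]
    refine mul_le_mul_of_nonneg_right ?_ (sq_nonneg _)
    nlinarith [hν p hp]
  have h4 : m4 n ≤ 9 / 80 * (h ^ 4 * S4) := by
    rw [m4, hS4, Finset.mul_sum, Finset.mul_sum, Finset.mul_sum]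
    refine Finset.sum_le_sum fun p hp => ?_
    have h0 : h ^ 4 * (blk n p / h) ^ 4 = (n.factorization p : ℝ) ^ 4 * Real.log p ^ 4 := by
      rw [blk]
      field_simp
    rw [h0]
    set ν : ℝ := (n.factorization p : ℝ)
    have h1 := hν p hp
    have h5 : ν * (ν + 2) ≤ 3 * ν ^ 2 := by nlinarith
    have h6 : 3 * ν ^ 2 + 6 * ν - 4 ≤ 9 * ν ^ 2 := by nlinarith
    have h7 : ν * (ν + 2) * (3 * ν ^ 2 + 6 * ν - 4) ≤ 3 * ν ^ 2 * (9 * ν ^ 2) :=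
      mul_le_mul h5 h6 (by nlinarith) (by positivity)
    have h8 := mul_le_mul_of_nonneg_right h7 (show 0 ≤ Real.log p ^ 4 by positivity)
    calc 1 / 240 * (ν * (ν + 2) * (3 * ν ^ 2 + 6 * ν - 4) * Real.log p ^ 4)
        ≤ 1 / 240 * (3 * ν ^ 2 * (9 * ν ^ 2) * Real.log p ^ 4) := by linarith
      _ = 9 / 80 * (ν ^ 4 * Real.log p ^ 4) := by ring
  have h4pos : 0 < m4 n := by
    refine mul_pos (by norm_num) (Finset.sum_pos (fun p hp => ?_)
      (Nat.nonempty_primeFactors.2 (by omega)))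
    have h1 := hν p hp
    have h5 : 0 < Real.log p :=
      Real.log_pos (by exact_mod_cast (Nat.prime_of_mem_primeFactors hp).one_lt)
    have h6 : 0 < 3 * (n.factorization p : ℝ) ^ 2 + 6 * n.factorization p - 4 := by nlinarith
    positivity
  rw [wn, if_neg hn1, le_div_iff₀ h4pos]
  calc K * m4 n ≤ K * (9 / 80 * (h ^ 4 * S4)) := mul_le_mul_of_nonneg_left h4 hK
    _ = h ^ 4 / 720 * (81 * K * S4) := by ring
    _ ≤ h ^ 4 / 720 * (5 * S2 ^ 2) := mul_le_mul_of_nonneg_left hm (by positivity)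
    _ = (h ^ 2 * S2 / 12) ^ 2 := by ring
    _ ≤ m2 n ^ 2 := pow_le_pow_left₀ (by positivity) h2 2

/-- **Proposition 1.4**: `w_n ≥ Z⁴` outside a small exceptional set. -/
theorem stmt3 :
    ∃ c > (0:ℝ), ∃ C > (0:ℝ),
      ∀ x y Z : ℝ, 2 ≤ y → y ≤ x → 0 ≤ Z → Z ≤ c * ubar x y ^ ((1:ℝ)/4) →
        (((Sf x y).filter fun n => wn n < Z ^ 4).card : ℝ) ≤
          C * Real.exp (-c * Real.sqrt (ubar x y) / (Z + 1)) * Psi x y := by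
  obtain ⟨U₀, hU₀, C, hC, hsecond⟩ := exists_card_second_moment_lt_le
  refine ⟨1 / 10000, by norm_num, Real.exp 1 + C + Real.exp (√U₀), by positivity,
    fun x y Z hy hyx hZ0 hZ => ?_⟩
  set U := ubar x y with hU
  have hP0 := Psi_nonneg x y
  have hZ1 : 0 < Z + 1 := by linarith
  have hdiv : √U / (Z + 1) ≤ √U := div_le_self (Real.sqrt_nonneg U) (by linarith)
  have hexp : -(1 / 10000) * √U / (Z + 1) = -(1 / 10000 * (√U / (Z + 1))) := by ring
  have hq0 : 0 ≤ √U / (Z + 1) := by positivity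
  rw [hexp]
  set q := √U / (Z + 1) with hq
  rcases lt_or_ge U U₀ with hlt | hge
  · have h1 : (((Sf x y).filter fun n => wn n < Z ^ 4).card : ℝ) ≤ Psi x y :=
      Nat.cast_le.2 (Finset.card_le_card (Finset.filter_subset _ _))
    refine h1.trans (le_mul_of_one_le_left hP0 ?_)
    have h2 : √U ≤ √U₀ := Real.sqrt_le_sqrt hlt.le
    calc (1 : ℝ) ≤ Real.exp (√U₀ + -(1 / 10000 * q)) := Real.one_le_exp (by linarith)
      _ = Real.exp (√U₀) * Real.exp (-(1 / 10000 * q)) := Real.exp_add _ _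
      _ ≤ _ := mul_le_mul_of_nonneg_right (by have := Real.exp_pos 1; linarith)
        (Real.exp_pos _).le
  have hx0 : 0 < x := by linarith
  have hU1 : 1 ≤ U := hU₀.trans hge
  have hU0 : 0 < U := by linarith
  have hL0 : 0 < Real.log y := Real.log_pos (by linarith)
  set T := Real.log x with hT
  have hxT : Real.exp T = x := Real.exp_log hx0
  have hUl : U ≤ T / Real.log y := min_le_left _ _
  have hUr : U ≤ (primesUpTo y).card := min_le_right _ _
  have hTU : U * Real.log y ≤ T := (le_div_iff₀ hL0).1 hUl
  have hT0 : 0 < T := lt_of_lt_of_le (by positivity) hTU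
  set h := T / U with hh
  have hh0 : 0 < h := by positivity
  have hTh : T / h = U := by rw [hh]; field_simp
  have hLh : Real.log y ≤ h := by
    rw [hh, le_div_iff₀ hU0]
    linarith
  have hTk : T ≤ (primesUpTo y).card * h := by
    rw [← div_le_iff₀ hh0, hTh]
    exact hUr
  set B := 1 / 1000 * q with hB
  have hB0 : 0 ≤ B := by positivity
  have hA := hsecond y T U hy rfl hge
  have hF := card_fourth_moment_gt_le hy hLh hTk hT0.le hB0
  rw [hTh] at hF
  rw [hxT] at hA hF
  have hsub : ((Sf x y).filter fun n => wn n < Z ^ 4) ⊆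
      ((Sf x y).filter fun n => 57000001 * U + 14000 * B ^ 4 <
        ∑ p ∈ n.primeFactors, (blk n p / h) ^ 4) ∪
      ((Sf x y).filter fun n => ∑ p ∈ n.primeFactors, (blk n p / h) ^ 2 < U / 1024) := by
    intro n hn
    rw [Finset.mem_filter] at hn
    rw [Finset.mem_union, Finset.mem_filter, Finset.mem_filter]
    by_contra! hcon
    have h4 := hcon.1 hn.1
    have h2 := hcon.2 hn.1
    have hn1 : n ≠ 1 := by
      rintro rfl
      rw [Nat.primeFactors_one, Finset.sum_empty] at h2
      linarith
    refine (le_wn_of_moments (mem_Sf.1 hn.1).1 hn1 hh0 (by positivity) ?_).not_gt hn.2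
    have hZ4 : Z ^ 4 ≤ 1 / 10 ^ 16 * U := by
      calc Z ^ 4 ≤ (1 / 10000 * U ^ ((1 : ℝ) / 4)) ^ 4 := pow_le_pow_left₀ hZ0 hZ 4
        _ = 1 / 10 ^ 16 * U := by
          rw [mul_pow, ← Real.rpow_mul_natCast hU0.le]
          norm_num
    have hZB : Z ^ 4 * B ^ 4 ≤ 1 / 10 ^ 12 * U ^ 2 := by
      have h5 : Z * B ≤ 1 / 1000 * √U := by
        have h6 : Z * q ≤ √U := by
          rw [hq, mul_div_assoc', div_le_iff₀ hZ1]
          nlinarith [Real.sqrt_nonneg U]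
        rw [hB]
        linarith
      calc Z ^ 4 * B ^ 4 = (Z * B) ^ 4 := by ring
        _ ≤ (1 / 1000 * √U) ^ 4 := pow_le_pow_left₀ (by positivity) h5 4
        _ = 1 / 10 ^ 12 * (√U ^ 2) ^ 2 := by ring
        _ = 1 / 10 ^ 12 * U ^ 2 := by rw [Real.sq_sqrt hU0.le]
    calc 81 * Z ^ 4 * ∑ p ∈ n.primeFactors, (blk n p / h) ^ 4
        ≤ 81 * Z ^ 4 * (57000001 * U + 14000 * B ^ 4) :=
          mul_le_mul_of_nonneg_left h4 (by positivity)
      _ = 81 * 57000001 * (Z ^ 4 * U) + 81 * 14000 * (Z ^ 4 * B ^ 4) := by ring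
      _ ≤ 81 * 57000001 * (1 / 10 ^ 16 * U * U) + 81 * 14000 * (1 / 10 ^ 12 * U ^ 2) := by
          gcongr
      _ ≤ 5 * (U / 1024) ^ 2 := by nlinarith [sq_nonneg U]
      _ ≤ 5 * (∑ p ∈ n.primeFactors, (blk n p / h) ^ 2) ^ 2 := by gcongr
  have h1 : (((Sf x y).filter fun n => wn n < Z ^ 4).card : ℝ) ≤ _ :=
    Nat.cast_le.2 ((Finset.card_le_card hsub).trans (Finset.card_union_le _ _))
  rw [Nat.cast_add] at h1
  have h2 : Real.exp (1 - B) ≤ Real.exp 1 * Real.exp (-(1 / 10000 * q)) := by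
    rw [← Real.exp_add, Real.exp_le_exp, hB]
    linarith
  have h3 : Real.exp (-(U / 64)) ≤ Real.exp (-(1 / 10000 * q)) := by
    rw [Real.exp_le_exp]
    have : √U ≤ U := by
      rw [Real.sqrt_le_left hU0.le]
      nlinarith
    linarith
  calc _ ≤ _ := h1
    _ ≤ _ := add_le_add hF hA
    _ = (Real.exp (1 - B) + C * Real.exp (-(U / 64))) * Psi x y := by ring
    _ ≤ (Real.exp 1 * Real.exp (-(1 / 10000 * q)) + C * Real.exp (-(1 / 10000 * q))) *
        Psi x y := by gcongr
    _ ≤ _ := by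
      refine mul_le_mul_of_nonneg_right ?_ hP0
      have := mul_pos (Real.exp_pos (√U₀)) (Real.exp_pos (-(1 / 10000 * q)))
      linarith

end
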